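/- Let f ≥ 3 be an odd integer, let S = PSL₂(3^f), and let G be a group with Inn(S) < G ≤ Aut(S), where S is identified with Inn(S). If there exists a subgroup H with Inn(S) < H ≤ G such that H ≅ PGL₂(3^f), then G has a rational irreducible complex character of even degree whose kernel does not contain Inn(S), and G has a non-trivial rational element of odd order lying in Inn(S). -/

import Mathlib

open CategoryTheory

/-- An element `x` of a finite group is *rational* if it is conjugate to every
generator of the cyclic group `⟨x⟩`. -/
def IsRationalElement {G : Type*} [Group G] (x : G) : Prop :=
  ∀ y : G, Subgroup.zpowers y = Subgroup.zpowers x → IsConj x y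

instance : Fact (Nat.Prime 3) := ⟨by norm_num⟩

/-- `SL₂(F)`. -/
abbrev SL2 (F : Type*) [CommRing F] := Matrix.SpecialLinearGroup (Fin 2) F

/-- `PSL₂(F) = SL₂(F)/Z(SL₂(F))`. -/
abbrev PSL2 (F : Type*) [CommRing F] := SL2 F ⧸ Subgroup.center (SL2 F)

/-- `PGL₂(F) = GL₂(F)/Z(GL₂(F))`. -/
abbrev PGL2 (F : Type*) [CommRing F] :=
  Matrix.GeneralLinearGroup (Fin 2) F ⧸
    Subgroup.center (Matrix.GeneralLinearGroup (Fin 2) F)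

/-- The subgroup of inner automorphisms of `S` inside `Aut(S)`. -/
def innAut (S : Type*) [Group S] : Subgroup (MulAut S) :=
  (MulAut.conj : S →* MulAut S).range

instance innAut_normal (S : Type*) [Group S] : (innAut S).Normal := by
  constructor
  rintro α ⟨s, rfl⟩ β
  refine ⟨β s, ?_⟩
  ext x
  simp [MulAut.conj]

section Kirillov
open Finset

set_option linter.unusedSectionVars false
variable {F : Type*} [Field F] [Fintype F] [DecidableEq F]

/-- complex quadratic character -/
noncomputable def qch (F : Type*) [Field F] [Fintype F] [DecidableEq F] : MulChar F ℂ :=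
  (quadraticChar F).ringHomComp (Int.castRingHom ℂ)

/-- the Bessel function, up to the Gauss sum -/
noncomputable def bes (ψ : AddChar F ℂ) (v : F) : ℂ :=
  (gaussSum (qch F) ψ)⁻¹ * ∑ s : F, if s ^ 2 = v then qch F s * ψ s else 0

lemma ringChar_ne_two [CharP F 3] : ringChar F ≠ 2 := by
  rw [ringChar.eq F 3]; norm_num

lemma qch_apply (a : F) : qch F a = ((quadraticChar F a : ℤ) : ℂ) := rfl

lemma qch_neg_one (hsq : ¬ IsSquare (-1 : F)) : qch F (-1) = -1 := by
  rw [qch_apply, quadraticChar_neg_one_iff_not_isSquare.2 hsq]; simp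

lemma qch_neg (hsq : ¬ IsSquare (-1 : F)) (a : F) : qch F (-a) = - qch F a := by
  rw [neg_eq_neg_one_mul, map_mul, qch_neg_one hsq]; ring

lemma qch_mul_self {a : F} (ha : a ≠ 0) : qch F a * qch F a = 1 := by
  rw [qch_apply, ← Int.cast_mul, ← sq, quadraticChar_sq_one ha]; simp

lemma qch_inv (a : F) : qch F a⁻¹ = qch F a := by
  by_cases ha : a = 0
  · simp [ha]
  have h1 : qch F a⁻¹ * qch F a = 1 := by rw [← map_mul, inv_mul_cancel₀ ha, map_one]
  have h2 := qch_mul_self ha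
  calc qch F a⁻¹ = qch F a⁻¹ * (qch F a * qch F a) := by rw [h2, mul_one]
    _ = _ := by rw [← mul_assoc, h1, one_mul]

lemma sum_sq_comp [CharP F 3] (h : F → ℂ) : ∑ s : F, h (s ^ 2) = ∑ y : F, (1 + qch F y) * h y := by
  have : ∀ y : F, (1 + qch F y) = ∑ s : F, if s ^ 2 = y then (1 : ℂ) else 0 := by
    intro y
    have := quadraticChar_card_sqrts (F := F) ringChar_ne_two y
    rw [qch_apply, Finset.sum_boole]
    have h2 : ((({x : F | x ^ 2 = y}.toFinset.card : ℤ)) : ℂ) = ((quadraticChar F y + 1 : ℤ) : ℂ) := by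
      rw [this]
    push_cast at h2
    rw [add_comm, ← h2]
    congr 2
    ext s; simp
  simp_rw [this, Finset.sum_mul]
  rw [Finset.sum_comm]
  refine Finset.sum_congr rfl fun s _ => ?_
  simp

lemma gauss_quad [CharP F 3] (ψ : AddChar F ℂ) (hψ : ψ ≠ 1) {b : F} (hb : b ≠ 0) :
    ∑ s : F, ψ (b * s ^ 2) = qch F b * gaussSum (qch F) ψ := by
  rw [sum_sq_comp (fun y => ψ (b * y))]
  simp_rw [add_mul, one_mul]
  rw [Finset.sum_add_distrib]
  have h1 : ∑ y : F, ψ (b * y) = 0 := by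
    have hp := AddChar.IsPrimitive.of_ne_one hψ
    simpa [hb, mul_comm] using AddChar.sum_mulShift (R := F) b hp
  have h2 := gaussSum_mulShift (qch F) ψ (Units.mk0 b hb)
  have h3 : ∑ y : F, qch F y * ψ (b * y) = gaussSum (qch F) (AddChar.mulShift ψ b) := by
    simp [gaussSum, AddChar.mulShift_apply]
  simp only [Units.val_mk0] at h2
  rw [h1, zero_add, h3, ← h2, ← mul_assoc, qch_mul_self hb, one_mul]

lemma gauss_quad_lin [CharP F 3] (ψ : AddChar F ℂ) (hψ : ψ ≠ 1) {b : F} (hb : b ≠ 0) (c : F) :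
    ∑ s : F, ψ (b * s ^ 2 + c * s) = ψ (- c ^ 2 / b) * qch F b * gaussSum (qch F) ψ := by
  have h3 : (3 : F) = 0 := by exact_mod_cast CharP.cast_eq_zero F 3
  rw [mul_assoc, ← gauss_quad ψ hψ hb, Finset.mul_sum]
  rw [← Equiv.sum_comp (Equiv.addRight (c / b))]
  refine Finset.sum_congr rfl fun s _ => ?_
  rw [← AddChar.map_add_eq_mul]
  congr 1
  simp only [Equiv.coe_addRight]
  field_simp
  linear_combination (c * s * b + c^2) * h3

lemma sum_lin [CharP F 3] (ψ : AddChar F ℂ) (hψ : ψ ≠ 1) (c : F) :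
    ∑ s : F, ψ (c * s) = if c = 0 then (Fintype.card F : ℂ) else 0 := by
  have hp := AddChar.IsPrimitive.of_ne_one hψ
  have := AddChar.sum_mulShift (R := F) c hp
  simp only [mul_comm c]
  exact_mod_cast this

lemma gauss_sq [CharP F 3] (hsq : ¬ IsSquare (-1 : F)) (ψ : AddChar F ℂ) (hψ : ψ ≠ 1) :
    gaussSum (qch F) ψ ^ 2 = - (Fintype.card F : ℂ) := by
  have hp := AddChar.IsPrimitive.of_ne_one hψ
  have hne : qch F ≠ 1 := by
    intro h
    have := qch_neg_one hsq
    rw [h, MulChar.one_apply (by simp)] at this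
    norm_num at this
  have hq : (qch F).IsQuadratic := (quadraticChar_isQuadratic F).comp _
  rw [gaussSum_sq hne hq hp, qch_neg_one hsq]
  simp

lemma gauss_ne [CharP F 3] (hsq : ¬ IsSquare (-1 : F)) (ψ : AddChar F ℂ) (hψ : ψ ≠ 1) :
    gaussSum (qch F) ψ ≠ 0 := by
  intro h
  have := gauss_sq hsq ψ hψ
  rw [h] at this
  simp at this

lemma bes_zero (ψ : AddChar F ℂ) : bes ψ 0 = 0 := by
  simp [bes, qch_apply]

lemma bes_nonsq (ψ : AddChar F ℂ) {v : F} (hv : ¬ IsSquare v) : bes ψ v = 0 := by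
  unfold bes
  rw [Finset.sum_eq_zero, mul_zero]
  intro s _
  rw [if_neg]
  rintro rfl
  exact hv ⟨s, by ring⟩

lemma bes_sq [CharP F 3] (hsq : ¬ IsSquare (-1 : F)) (ψ : AddChar F ℂ) (r : F) :
    bes ψ (r ^ 2) = (gaussSum (qch F) ψ)⁻¹ * (qch F r * (ψ r - ψ (-r))) := by
  by_cases hr : r = 0
  · simp [hr, bes_zero]
  unfold bes
  congr 1
  have hne : r ≠ -r := by
    intro h
    have h2 : (2 : F) * r = 0 := by linear_combination h
    have h3 : (3 : F) = 0 := by exact_mod_cast CharP.cast_eq_zero F 3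
    apply hr
    linear_combination r * h3 - h2
  have : ∀ s : F, (if s ^ 2 = r ^ 2 then qch F s * ψ s else 0)
      = (if s = r then qch F s * ψ s else 0) + (if s = -r then qch F s * ψ s else 0) := by
    intro s
    by_cases h1 : s = r
    · subst h1; simp [hne]
    by_cases h2 : s = -r
    · subst h2; simp [Ne.symm hne]
    · have : s ^ 2 ≠ r ^ 2 := by
        intro h
        rcases sq_eq_sq_iff_eq_or_eq_neg.1 h with h | h <;> contradiction
      simp [h1, h2, this]
  simp_rw [this]
  rw [Finset.sum_add_distrib]
  simp [qch_neg hsq]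
  ring

lemma sum_half [CharP F 3] (h : F → ℂ) (h0 : h 0 = 0) (hn : ∀ y, ¬ IsSquare y → h y = 0) :
    2 * ∑ y : F, h y = ∑ s : F, h (s ^ 2) := by
  rw [sum_sq_comp, Finset.mul_sum]
  refine Finset.sum_congr rfl fun y _ => ?_
  by_cases hy : y = 0
  · simp [hy, h0]
  by_cases hs : IsSquare y
  · rw [qch_apply, (quadraticChar_one_iff_isSquare hy).2 hs]; norm_num
  · simp [hn y hs]

lemma isSquare_or_neg (hsq : ¬ IsSquare (-1 : F)) (a : F) : IsSquare a ∨ IsSquare (-a) := by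
  by_cases ha : a = 0
  · left; simp [ha]
  by_contra! h
  obtain ⟨h1, h2⟩ := h
  have e1 := quadraticChar_neg_one_iff_not_isSquare.2 h1
  have e2 := quadraticChar_neg_one_iff_not_isSquare.2 h2
  have e3 := quadraticChar_neg_one_iff_not_isSquare.2 hsq
  rw [neg_eq_neg_one_mul, map_mul, e1, e3] at e2
  norm_num at e2

/-- the case of squares -/
lemma bes_conv_sq [CharP F 3] (hsq : ¬ IsSquare (-1 : F)) (ψ : AddChar F ℂ) (hψ : ψ ≠ 1)
    (r t : F) (hr : r ≠ 0) (ht : t ≠ 0) (b : F) :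
    ∑ y : F, ψ (b * y) * bes ψ (r ^ 2 * y) * bes ψ (y * t ^ 2) =
      if b = 0 then (if r ^ 2 = t ^ 2 then 1 else 0)
      else ψ (- (r ^ 2 + t ^ 2) / b) * bes ψ (r ^ 2 * t ^ 2 / b ^ 2) := by
  have h3 : (3 : F) = 0 := by exact_mod_cast CharP.cast_eq_zero F 3
  have hg := gauss_ne hsq ψ hψ
  have hg2 := gauss_sq hsq ψ hψ
  set g := gaussSum (qch F) ψ with hgdef
  have h2 : (2 : ℂ) ≠ 0 := by norm_num
  apply mul_left_cancel₀ h2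
  rw [sum_half]
  rotate_left
  · simp [bes_zero]
  · intro y hy
    rw [bes_nonsq ψ (v := r ^ 2 * y), mul_zero, zero_mul]
    rintro ⟨s, hs⟩
    exact hy ⟨s / r, by field_simp; linear_combination hs⟩
  have e1 : ∀ s : F, ψ (b * s ^ 2) * bes ψ (r ^ 2 * s ^ 2) * bes ψ (s ^ 2 * t ^ 2)
      = g⁻¹ * g⁻¹ * (qch F r * qch F t) * (
        ψ (b * s ^ 2 + (r + t) * s) + ψ (b * s ^ 2 + (-(r + t)) * s)
        - ψ (b * s ^ 2 + (r - t) * s) - ψ (b * s ^ 2 + (-(r - t)) * s)) := by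
    intro s
    rw [← mul_pow, ← mul_pow, bes_sq hsq, bes_sq hsq]
    by_cases hs : s = 0
    · subst hs; simp
    have hqs := qch_mul_self hs
    simp only [map_mul]
    have p1 : ψ (b * s ^ 2 + (r + t) * s) = ψ (b * s^2) * (ψ (r * s) * ψ (s * t)) := by
      rw [← AddChar.map_add_eq_mul, ← AddChar.map_add_eq_mul]; congr 1; ring
    have p2 : ψ (b * s ^ 2 + (-(r + t)) * s) = ψ (b * s^2) * (ψ (-(r * s)) * ψ (-(s * t))) := by
      rw [← AddChar.map_add_eq_mul, ← AddChar.map_add_eq_mul]; congr 1; ring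
    have p3 : ψ (b * s ^ 2 + (r - t) * s) = ψ (b * s^2) * (ψ (r * s) * ψ (-(s * t))) := by
      rw [← AddChar.map_add_eq_mul, ← AddChar.map_add_eq_mul]; congr 1; ring
    have p4 : ψ (b * s ^ 2 + (-(r - t)) * s) = ψ (b * s^2) * (ψ (-(r * s)) * ψ (s * t)) := by
      rw [← AddChar.map_add_eq_mul, ← AddChar.map_add_eq_mul]; congr 1; ring
    rw [p1, p2, p3, p4]
    linear_combination (ψ (b * s ^ 2) * g⁻¹ * g⁻¹ * qch F r * qch F t * (ψ (r * s) - ψ (-(r * s))) * (ψ (s * t) - ψ (-(s * t)))) * hqs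
  simp_rw [e1]
  rw [← Finset.mul_sum, Finset.sum_sub_distrib, Finset.sum_sub_distrib, Finset.sum_add_distrib]
  by_cases hb : b = 0
  · subst hb
    simp only [zero_mul, zero_add, if_true, sum_lin ψ hψ, neg_eq_zero]
    by_cases h1 : r = t
    · subst h1
      have : r + r ≠ 0 := by
        intro h; apply hr; linear_combination r * h3 - h
      simp only [this, if_false, sub_self, if_true]
      rw [qch_mul_self hr]
      field_simp
      linear_combination (-2) * hg2
    · by_cases h2 : r = -t
      · subst h2
        have : -t - t ≠ 0 := by
          intro h; apply ht; linear_combination t * h3 + h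
        simp only [this, if_false, neg_add_cancel, if_true]
        rw [qch_neg hsq, neg_mul, qch_mul_self ht]
        simp only [neg_sq, if_true]
        field_simp
        linear_combination (-2) * hg2
      · have a1 : r + t ≠ 0 := fun h => h2 (by linear_combination h)
        have a2 : r - t ≠ 0 := fun h => h1 (by linear_combination h)
        have a3 : ¬ r ^ 2 = t ^ 2 := by
          intro h
          rcases sq_eq_sq_iff_eq_or_eq_neg.1 h with h | h <;> contradiction
        simp [a1, a2, a3]
  · simp only [hb, if_false, gauss_quad_lin ψ hψ hb, neg_sq]
    have e2 : r ^ 2 * t ^ 2 / b ^ 2 = (r * t * b⁻¹) ^ 2 := by field_simp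
    rw [e2, bes_sq hsq, ← hgdef]
    have q1 : ψ (-(r + t) ^ 2 / b) = ψ (-(r ^ 2 + t ^ 2) / b) * ψ (r * t * b⁻¹) := by
      rw [← AddChar.map_add_eq_mul]; congr 1; field_simp; linear_combination (-r * t) * h3
    have q2 : ψ (-(r - t) ^ 2 / b) = ψ (-(r ^ 2 + t ^ 2) / b) * ψ (-(r * t * b⁻¹)) := by
      rw [← AddChar.map_add_eq_mul]; congr 1; field_simp; linear_combination (r * t) * h3
    rw [q1, q2]
    simp only [map_mul, qch_inv]
    field_simp
    ring

lemma bes_conv [CharP F 3] (hsq : ¬ IsSquare (-1 : F)) (ψ : AddChar F ℂ) (hψ : ψ ≠ 1)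
    (x z : F) (hx : x ≠ 0) (hz : z ≠ 0) (b : F) :
    ∑ y : F, ψ (b * y) * bes ψ (x * y) * bes ψ (y * z) =
      if b = 0 then (if x = z then 1 else 0)
      else ψ (- (x + z) / b) * bes ψ (x * z / b ^ 2) := by
  have mixed : ∀ x z : F, x ≠ 0 → z ≠ 0 → IsSquare x → IsSquare (-z) → 
      ∑ y : F, ψ (b * y) * bes ψ (x * y) * bes ψ (y * z) =
      if b = 0 then (if x = z then 1 else 0)
      else ψ (- (x + z) / b) * bes ψ (x * z / b ^ 2) := by
    rintro x z hx hz ⟨r, hr⟩ ⟨t, ht⟩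
    have hr0 : r ≠ 0 := by rintro rfl; simp at hr; exact hx hr
    have ht0 : t ≠ 0 := by rintro rfl; simp at ht; exact hz ht
    have hxz : x ≠ z := by
      rintro rfl
      exact hsq ⟨t / r, by field_simp; linear_combination ht + hr⟩
    have hxz2 : ∀ b : F, b ≠ 0 → ¬ IsSquare (x * z / b ^ 2) := by
      rintro b hb ⟨s, hs⟩
      refine hsq ⟨s * b / (r * t), ?_⟩
      field_simp at hs ⊢
      rw [hr, ← neg_neg z, ht] at hs
      linear_combination hs
    rw [Finset.sum_eq_zero]
    · split_ifs with h
      · rfl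
      · rw [bes_nonsq _ (hxz2 b h), mul_zero]
    · intro y _
      by_cases hy0 : y = 0
      · simp [hy0, bes_zero]
      rcases isSquare_or_neg hsq y with ⟨s, hs⟩ | ⟨s, hs⟩
      · have : ¬ IsSquare (y * z) := by
          rintro ⟨v, hv⟩
          have hs0 : s ≠ 0 := by rintro rfl; simp at hs; exact hy0 hs
          refine hsq ⟨v / (s * t), ?_⟩
          field_simp
          rw [hs, ← neg_neg z, ht] at hv
          linear_combination hv
        rw [bes_nonsq _ this, mul_zero]
      · have : ¬ IsSquare (x * y) := by
          rintro ⟨v, hv⟩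
          have hs0 : s ≠ 0 := by rintro rfl; simp at hs; exact hy0 hs
          refine hsq ⟨v / (s * r), ?_⟩
          field_simp
          rw [hr, ← neg_neg y, hs] at hv
          linear_combination hv
        rw [bes_nonsq _ this, mul_zero, zero_mul]
  rcases isSquare_or_neg hsq x with hx1 | hx1 <;> rcases isSquare_or_neg hsq z with hz1 | hz1
  · obtain ⟨r, rfl⟩ := hx1
    obtain ⟨t, rfl⟩ := hz1
    have hr0 : r ≠ 0 := by rintro rfl; simp at hx
    have ht0 : t ≠ 0 := by rintro rfl; simp at hz
    simpa [sq] using bes_conv_sq hsq ψ hψ r t hr0 ht0 b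
  · exact mixed x z hx hz hx1 hz1
  · have := mixed z x hz hx hz1 hx1
    simp only [add_comm x z, mul_comm x z, eq_comm (a := x) (b := z)]
    rw [← this]
    refine Finset.sum_congr rfl fun y _ => ?_
    rw [mul_comm x y, mul_comm y z]; ring
  · obtain ⟨r, hr⟩ := hx1
    obtain ⟨t, ht⟩ := hz1
    have hr0 : r ≠ 0 := by rintro rfl; simp at hr; exact hx hr
    have ht0 : t ≠ 0 := by rintro rfl; simp at ht; exact hz ht
    have hx' : x = - r ^ 2 := by linear_combination -hr
    have hz' : z = - t ^ 2 := by linear_combination -ht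
    have := bes_conv_sq hsq ψ hψ r t hr0 ht0 (-b)
    rw [← Equiv.sum_comp (Equiv.neg F)] at this
    subst hx' hz'
    have e1 : -(-r ^ 2 + -t ^ 2) / b = -(r ^ 2 + t ^ 2) / -b := by
      by_cases hb : b = 0
      · simp [hb]
      field_simp
      ring
    rw [e1]
    simpa using this

end Kirillov

section Kirillov2
open Finset Matrix
set_option linter.unusedSectionVars false

variable {F : Type*} [Field F] [Fintype F] [DecidableEq F]

/-- The Kirillov-model matrix of an element of `GL₂`. -/
noncomputable def kir (ψ : AddChar F ℂ) (g : GL (Fin 2) F) : Matrix Fˣ Fˣ ℂ := fun x z =>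
  if g 1 0 = 0 then ψ (g 0 1 * x / g 1 1) * (if (z : F) * g 1 1 = g 0 0 * x then 1 else 0)
  else ψ ((g 0 0 * x + g 1 1 * z) / g 1 0) *
    bes ψ (x * z * (g 0 0 * g 1 1 - g 0 1 * g 1 0) / (g 1 0) ^ 2)

lemma gl_det_ne (g : GL (Fin 2) F) : g 0 0 * g 1 1 - g 0 1 * g 1 0 ≠ 0 := by
  have := Matrix.GeneralLinearGroup.det_ne_zero g
  rwa [Matrix.det_fin_two] at this

/-- matrices in `GL₂` from entries -/
noncomputable def mkGL (a b c d : F) (h : a * d - b * c ≠ 0) : GL (Fin 2) F :=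
  Matrix.GeneralLinearGroup.mkOfDetNeZero !![a, b; c, d] (by rwa [Matrix.det_fin_two_of])

@[simp] lemma mkGL_00 (a b c d : F) (h) : mkGL a b c d h 0 0 = a := rfl
@[simp] lemma mkGL_01 (a b c d : F) (h) : mkGL a b c d h 0 1 = b := rfl
@[simp] lemma mkGL_10 (a b c d : F) (h) : mkGL a b c d h 1 0 = c := rfl
@[simp] lemma mkGL_11 (a b c d : F) (h) : mkGL a b c d h 1 1 = d := rfl

lemma gl_ext {g h : GL (Fin 2) F} (h00 : g 0 0 = h 0 0) (h01 : g 0 1 = h 0 1)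
    (h10 : g 1 0 = h 1 0) (h11 : g 1 1 = h 1 1) : g = h := by
  apply Matrix.GeneralLinearGroup.ext
  intro i j
  fin_cases i <;> fin_cases j <;> assumption

lemma gl_mul_apply (g h : GL (Fin 2) F) (i j : Fin 2) :
    (g * h) i j = g i 0 * h 0 j + g i 1 * h 1 j := by
  rw [Matrix.GeneralLinearGroup.coe_mul, Matrix.mul_apply, Fin.sum_univ_two]

lemma kir_one (ψ : AddChar F ℂ) : kir ψ 1 = 1 := by
  ext x z
  simp [kir, Matrix.one_apply, eq_comm, Units.ext_iff]

lemma kir_borel_mul (ψ : AddChar F ℂ) (b h : GL (Fin 2) F) (hb : b 1 0 = 0) :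
    kir ψ (b * h) = kir ψ b * kir ψ h := by
  have hd := gl_det_ne b
  have hdh := gl_det_ne h
  rw [hb, mul_zero, sub_zero] at hd
  have ha0 : b 0 0 ≠ 0 := left_ne_zero_of_mul hd
  have hd0 : b 1 1 ≠ 0 := right_ne_zero_of_mul hd
  ext x z
  rw [Matrix.mul_apply]
  have hx0 : (x : F) ≠ 0 := x.ne_zero
  have hz0 : (z : F) ≠ 0 := z.ne_zero
  set y0 : Fˣ := Units.mk0 (b 0 0 * x / b 1 1) (by positivity) with hy0
  rw [Finset.sum_eq_single y0]
  rotate_left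
  · intro y _ hy
    have : ¬ ((y : F) * b 1 1 = b 0 0 * x) := by
      intro h
      apply hy
      ext
      rw [hy0, Units.val_mk0]
      field_simp
      exact h
    simp [kir, hb, this]
  · simp
  have e1 : (y0 : F) * b 1 1 = b 0 0 * x := by rw [hy0, Units.val_mk0]; field_simp
  have e2 : (y0 : F) = b 0 0 * x / b 1 1 := by rw [hy0, Units.val_mk0]
  simp only [kir, gl_mul_apply, hb, if_true, e1, zero_mul, zero_add, mul_one, mul_zero, add_zero]
  by_cases hc : h 1 0 = 0
  · rw [hc, mul_zero, sub_zero] at hdh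
    have ha0' : h 0 0 ≠ 0 := left_ne_zero_of_mul hdh
    have hd0' : h 1 1 ≠ 0 := right_ne_zero_of_mul hdh
    simp only [hc, mul_zero, if_true, add_zero]
    rw [← mul_assoc (ψ _) (ψ _), ← AddChar.map_add_eq_mul, e2]
    congr 1
    · congr 1; field_simp; ring
    · congr 1
      apply propext
      constructor
      · intro h; field_simp; linear_combination h
      · intro h; field_simp at h; linear_combination h
  · have : b 1 1 * h 1 0 ≠ 0 := mul_ne_zero hd0 hc
    simp only [hc, this, if_false]
    rw [← mul_assoc (ψ _) (ψ _), ← AddChar.map_add_eq_mul, e2]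
    congr 1
    · congr 1; field_simp; ring
    · congr 1; field_simp; ring

/-- the Weyl element -/
noncomputable def weyl (F : Type*) [Field F] : GL (Fin 2) F := mkGL 0 (-1) 1 0 (by simp)

lemma sum_units (h : F → ℂ) (h0 : h 0 = 0) : ∑ y : Fˣ, h y = ∑ y : F, h y := by
  rw [← Finset.sum_subset (Finset.subset_univ (Finset.univ.erase (0 : F)))]
  · refine Finset.sum_bij (fun y _ => (y : F)) (by simp) (by simp [Units.ext_iff]) ?_ (by simp)
    intro y hy
    have : y ≠ 0 := by simpa using hy
    exact ⟨Units.mk0 y this, by simp, rfl⟩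
  · intro y _ hy
    have : y = 0 := by simpa using hy
    rw [this, h0]

lemma kir_weyl_mul [CharP F 3] (hsq : ¬ IsSquare (-1 : F)) (ψ : AddChar F ℂ) (hψ : ψ ≠ 1)
    (h : GL (Fin 2) F) : kir ψ (weyl F * h) = kir ψ (weyl F) * kir ψ h := by
  have hdh := gl_det_ne h
  ext x z
  have hx0 : (x : F) ≠ 0 := x.ne_zero
  have hz0 : (z : F) ≠ 0 := z.ne_zero
  rw [Matrix.mul_apply]
  have e0 : ∀ y : Fˣ, kir ψ (weyl F) x y = bes ψ (x * y) := by
    intro y; simp [kir, weyl]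
  simp only [e0]
  simp only [kir, gl_mul_apply]
  have w00 : weyl F 0 0 = 0 := rfl
  have w01 : weyl F 0 1 = -1 := rfl
  have w10 : weyl F 1 0 = 1 := rfl
  have w11 : weyl F 1 1 = 0 := rfl
  simp only [w00, w01, w10, w11, zero_mul, zero_add, one_mul, add_zero]
  by_cases hc : h 1 0 = 0
  · rw [hc, mul_zero, sub_zero] at hdh
    have ha0 : h 0 0 ≠ 0 := left_ne_zero_of_mul hdh
    have hd0 : h 1 1 ≠ 0 := right_ne_zero_of_mul hdh
    simp only [hc, ha0, if_true, if_false]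
    set y0 : Fˣ := Units.mk0 (z * h 1 1 / h 0 0) (by positivity) with hy0
    have e2 : (y0 : F) = z * h 1 1 / h 0 0 := by rw [hy0, Units.val_mk0]
    rw [Finset.sum_eq_single y0]
    rotate_left
    · intro y _ hy
      rw [if_neg, mul_zero, mul_zero]
      intro h
      apply hy
      ext
      rw [e2]
      field_simp
      linear_combination -h
    · simp
    rw [if_pos (by rw [e2]; field_simp), e2, mul_one, mul_comm]
    congr 1
    · congr 1; field_simp; ring
    · congr 1; field_simp; ring
  · simp only [hc, if_false]
    set z' : F := z * (h 0 0 * h 1 1 - h 0 1 * h 1 0) / h 1 0 ^ 2 with hz'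
    have hz'0 : z' ≠ 0 := by rw [hz']; positivity
    have e3 : ∀ y : Fˣ, bes ψ (x * y) * (ψ ((h 0 0 * y + h 1 1 * z) / h 1 0) *
        bes ψ (y * z * (h 0 0 * h 1 1 - h 0 1 * h 1 0) / h 1 0 ^ 2)) =
        ψ (h 1 1 * z / h 1 0) * (ψ (h 0 0 / h 1 0 * y) * bes ψ (x * y) * bes ψ (y * z')) := by
      intro y
      have : ψ ((h 0 0 * y + h 1 1 * z) / h 1 0) = ψ (h 1 1 * z / h 1 0) * ψ (h 0 0 / h 1 0 * y) := by
        rw [← AddChar.map_add_eq_mul]; congr 1; field_simp; ring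
      rw [this, hz']
      have : (y * z * (h 0 0 * h 1 1 - h 0 1 * h 1 0) / h 1 0 ^ 2 : F)
         = y * (z * (h 0 0 * h 1 1 - h 0 1 * h 1 0) / h 1 0 ^ 2) := by ring
      rw [this]
      ring
    simp only [e3]
    rw [← Finset.mul_sum, sum_units (fun y => ψ (h 0 0 / h 1 0 * y) * bes ψ (x * y) * bes ψ (y * z')) (by simp [bes_zero]),
      bes_conv hsq ψ hψ x z' hx0 hz'0]
    by_cases ha : h 0 0 = 0
    · rw [ha, zero_mul, zero_sub, neg_ne_zero] at hdh
      have hb0 : h 0 1 ≠ 0 := left_ne_zero_of_mul hdh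
      simp only [ha, zero_div, if_true]
      by_cases hxz : (x : F) = z'
      · have hxz2 := hxz
        rw [hz', ha, eq_div_iff (by positivity)] at hxz2
        have hxz3 : (x : F) * h 1 0 = - z * h 0 1 := by
          apply mul_right_cancel₀ hc
          linear_combination hxz2
        rw [if_pos hxz, if_pos (by linear_combination hxz3)]
        congr 2
        field_simp
        linear_combination (-h 1 1) * hxz3
      · rw [if_neg hxz, if_neg, mul_zero, mul_zero]
        intro h'
        apply hxz
        rw [hz', ha, eq_div_iff (by positivity)]
        linear_combination (h 1 0) * h'
    · have : h 0 0 / h 1 0 ≠ 0 := by positivity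
      simp only [ha, this, if_false]
      rw [← mul_assoc, ← AddChar.map_add_eq_mul]
      congr 1
      · congr 1
        rw [hz']
        field_simp
        ring
      · congr 1
        rw [hz']
        field_simp
        ring

lemma kir_mul [CharP F 3] (hsq : ¬ IsSquare (-1 : F)) (ψ : AddChar F ℂ) (hψ : ψ ≠ 1)
    (g h : GL (Fin 2) F) : kir ψ (g * h) = kir ψ g * kir ψ h := by
  by_cases hc : g 1 0 = 0
  · exact kir_borel_mul ψ g h hc
  have hd := gl_det_ne g
  set u : GL (Fin 2) F := mkGL 1 (g 0 0 / g 1 0) 0 1 (by simp) with hu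
  set b : GL (Fin 2) F := mkGL (g 1 0) (g 1 1) 0 ((g 0 0 * g 1 1 - g 0 1 * g 1 0) / g 1 0)
    (by rw [mul_zero, sub_zero]; positivity) with hb
  have hg : g = u * (weyl F * b) := by
    apply gl_ext <;> simp [gl_mul_apply, hu, hb, weyl] <;> field_simp
    ring
  have hu0 : u 1 0 = 0 := rfl
  have hb0 : b 1 0 = 0 := rfl
  rw [hg, mul_assoc, kir_borel_mul _ _ _ hu0, kir_borel_mul _ _ _ hu0, mul_assoc (weyl F),
    kir_weyl_mul hsq ψ hψ, kir_weyl_mul hsq ψ hψ, kir_borel_mul _ _ _ hb0]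
  simp only [Matrix.mul_assoc]

end Kirillov2

section Aut
open Matrix
set_option linter.unusedSectionVars false
set_option linter.unusedSimpArgs false

variable {F : Type*} [Field F]

/-- the action of field automorphisms on `GL₂` -/
def glAut (F : Type*) [Field F] : RingAut F →* MulAut (GL (Fin 2) F) where
  toFun σ :=
    { toFun := Matrix.GeneralLinearGroup.map (σ : F →+* F)
      invFun := Matrix.GeneralLinearGroup.map (σ.symm : F →+* F)
      left_inv := fun g => by
        apply Matrix.GeneralLinearGroup.ext; intro i j
        simp
      right_inv := fun g => by
        apply Matrix.GeneralLinearGroup.ext; intro i j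
        simp
      map_mul' := fun g h => map_mul _ g h }
  map_one' := by
    ext g i j
    simp
  map_mul' := fun σ τ => by
    ext g i j
    simp

lemma glAut_apply (σ : RingAut F) (g : GL (Fin 2) F) (i j : Fin 2) :
    glAut F σ g i j = σ (g i j) := by
  change Matrix.GeneralLinearGroup.map (σ : F →+* F) g i j = _
  simp

/-- `ΓL₂`. -/
abbrev GamL (F : Type*) [Field F] := GL (Fin 2) F ⋊[glAut F] RingAut F

/-- embedding of `SL₂` in `ΓL₂` -/
def iotaSL (F : Type*) [Field F] : SL2 F →* GamL F :=
  SemidirectProduct.inl.comp Matrix.SpecialLinearGroup.toGL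

lemma iotaSL_inj : Function.Injective (iotaSL F) :=
  SemidirectProduct.inl_injective.comp Matrix.SpecialLinearGroup.toGL_injective

lemma mem_iota_range (γ : GamL F) : γ ∈ (iotaSL F).range ↔
    γ.right = 1 ∧ (Matrix.GeneralLinearGroup.det γ.left) = 1 := by
  constructor
  · rintro ⟨X, rfl⟩
    refine ⟨rfl, ?_⟩
    change Matrix.GeneralLinearGroup.det (Matrix.SpecialLinearGroup.toGL X) = 1
    simp
  · rintro ⟨h1, h2⟩
    refine ⟨⟨γ.left.1, by
      have := congrArg Units.val h2
      simpa using this⟩, ?_⟩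
    apply SemidirectProduct.ext
    · apply Units.ext
      rfl
    · rw [h1]; rfl

instance iota_normal : (iotaSL F).range.Normal := by
  constructor
  intro n hn γ
  rw [mem_iota_range] at hn ⊢
  obtain ⟨h1, h2⟩ := hn
  refine ⟨by simp [h1], ?_⟩
  have e : (γ * n * γ⁻¹).left = γ.left * glAut F γ.right n.left * γ.left⁻¹ := by
    simp [h1, mul_assoc]
  rw [e]
  have : Matrix.GeneralLinearGroup.det (glAut F γ.right n.left) = 1 := by
    change Matrix.GeneralLinearGroup.det (Matrix.GeneralLinearGroup.map _ n.left) = 1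
    rw [Matrix.GeneralLinearGroup.map_det, h2, map_one]
  rw [map_mul, map_mul, this, mul_one, map_inv, mul_inv_cancel]

/-- action of `ΓL₂` on `SL₂` -/
noncomputable def slAct (F : Type*) [Field F] : GamL F →* MulAut (SL2 F) :=
  (MulAut.congr (MonoidHom.ofInjective (iotaSL_inj (F := F))).symm).toMonoidHom.comp
    (MulAut.conjNormal (H := (iotaSL F).range))

lemma iota_slAct (γ : GamL F) (X : SL2 F) :
    iotaSL F (slAct F γ X) = γ * iotaSL F X * γ⁻¹ := by
  have h1 : slAct F γ X = (MonoidHom.ofInjective (iotaSL_inj (F := F))).symm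
    (MulAut.conjNormal γ (MonoidHom.ofInjective (iotaSL_inj (F := F)) X)) := rfl
  rw [h1]
  have h2 : ∀ y : (iotaSL F).range,
      iotaSL F ((MonoidHom.ofInjective (iotaSL_inj (F := F))).symm y) = y := by
    intro y
    exact congrArg Subtype.val ((MonoidHom.ofInjective (iotaSL_inj (F := F))).apply_symm_apply y)
  rw [h2, MulAut.conjNormal_apply]
  rfl

lemma slAct_rel (γ : GamL F) (X : SL2 F) :
    Matrix.SpecialLinearGroup.toGL (slAct F γ X) * γ.left =
      γ.left * glAut F γ.right (Matrix.SpecialLinearGroup.toGL X) := by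
  have h := iota_slAct γ X
  have h2 := congrArg (fun y => (y * γ).left) h
  simpa [iotaSL] using h2

/-- passing to the central quotient -/
def autQuot (G : Type*) [Group G] : MulAut G →* MulAut (G ⧸ Subgroup.center G) where
  toFun e := QuotientGroup.congr _ _ e (Subgroup.characteristic_iff_map_eq.1 inferInstance e)
  map_one' := by
    ext x
    induction x using QuotientGroup.induction_on
    rfl
  map_mul' := fun e e' => by
    ext x
    induction x using QuotientGroup.induction_on
    rfl

/-- the map `ΓL₂ → Aut(PSL₂)` -/
noncomputable def Phi (F : Type*) [Field F] : GamL F →* MulAut (PSL2 F) :=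
  (autQuot (SL2 F)).comp (slAct F)

/-- projection -/
def mkP (F : Type*) [Field F] : SL2 F →* PSL2 F := QuotientGroup.mk' _

lemma mkP_surj : Function.Surjective (mkP F) := QuotientGroup.mk'_surjective _

lemma Phi_mk (γ : GamL F) (X : SL2 F) : Phi F γ (mkP F X) = mkP F (slAct F γ X) := rfl

lemma mkP_eq_one_iff (X : SL2 F) : mkP F X = 1 ↔ X = 1 ∨ X = -1 := by
  rw [mkP, ← MonoidHom.mem_ker, QuotientGroup.ker_mk', Matrix.SpecialLinearGroup.mem_center_iff]
  constructor
  · rintro ⟨r, hr, h⟩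
    rw [Fintype.card_fin] at hr
    rcases sq_eq_one_iff.1 hr with rfl | rfl
    · left; apply Subtype.ext; rw [← h]; simp
    · right; apply Subtype.ext; rw [← h]
      ext i j
      fin_cases i <;> fin_cases j <;> simp
  · rintro (rfl | rfl)
    · exact ⟨1, by simp, by simp⟩
    · refine ⟨-1, by simp, ?_⟩
      ext i j
      fin_cases i <;> fin_cases j <;> simp

lemma mkP_eq_iff (X Y : SL2 F) : mkP F X = mkP F Y ↔ X = Y ∨ X = -Y := by
  rw [← mul_inv_eq_one, ← map_inv, ← map_mul, mkP_eq_one_iff]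
  constructor
  · rintro (h | h)
    · left; exact mul_inv_eq_one.1 h
    · right
      have := congrArg (· * Y) h
      simpa using this
  · rintro (rfl | rfl)
    · left; simp
    · right; simp

/-- upper unipotent -/
def Uu (b : F) : SL2 F := ⟨!![1, b; 0, 1], by simp⟩
/-- Weyl element -/
def Ww (F : Type*) [Field F] : SL2 F := ⟨!![0, -1; 1, 0], by simp⟩
/-- torus element -/
def Dd (t : F) (ht : t ≠ 0) : SL2 F := ⟨!![t, 0; 0, t⁻¹], by simp [ht]⟩

lemma sl_ext {X Y : SL2 F} (h00 : X 0 0 = Y 0 0) (h01 : X 0 1 = Y 0 1)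
    (h10 : X 1 0 = Y 1 0) (h11 : X 1 1 = Y 1 1) : X = Y := by
  apply Matrix.SpecialLinearGroup.ext
  intro i j
  fin_cases i <;> fin_cases j <;> assumption

lemma sl_mul_apply (g h : SL2 F) (i j : Fin 2) :
    (g * h) i j = g i 0 * h 0 j + g i 1 * h 1 j := by
  rw [Matrix.SpecialLinearGroup.coe_mul, Matrix.mul_apply, Fin.sum_univ_two]

lemma sl_det (g : SL2 F) : g 0 0 * g 1 1 - g 0 1 * g 1 0 = 1 := by
  have := g.2
  rwa [Matrix.det_fin_two] at this

lemma sl_neg_apply (g : SL2 F) (i j : Fin 2) : (-g) i j = - g i j := rfl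

@[simp] lemma Uu00 (b : F) : Uu b 0 0 = 1 := rfl
@[simp] lemma Uu01 (b : F) : Uu b 0 1 = b := rfl
@[simp] lemma Uu10 (b : F) : Uu b 1 0 = 0 := rfl
@[simp] lemma Uu11 (b : F) : Uu b 1 1 = 1 := rfl
@[simp] lemma Ww00 : Ww F 0 0 = 0 := rfl
@[simp] lemma Ww01 : Ww F 0 1 = -1 := rfl
@[simp] lemma Ww10 : Ww F 1 0 = 1 := rfl
@[simp] lemma Ww11 : Ww F 1 1 = 0 := rfl
@[simp] lemma Dd00 (t : F) (ht) : Dd t ht 0 0 = t := rfl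
@[simp] lemma Dd01 (t : F) (ht) : Dd t ht 0 1 = 0 := rfl
@[simp] lemma Dd10 (t : F) (ht) : Dd t ht 1 0 = 0 := rfl
@[simp] lemma Dd11 (t : F) (ht) : Dd t ht 1 1 = t⁻¹ := rfl

lemma Uu_add (a b : F) : Uu (a + b) = Uu a * Uu b := by
  apply sl_ext <;> simp [sl_mul_apply, sl_neg_apply, -Matrix.SpecialLinearGroup.coe_mul, -Matrix.SpecialLinearGroup.coe_neg]
  ring

lemma Uu_zero : Uu (0 : F) = 1 := by
  apply sl_ext <;> simp

lemma Uu_neg (a : F) : Uu (-a) = (Uu a)⁻¹ := by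
  rw [eq_inv_iff_mul_eq_one, ← Uu_add, neg_add_cancel, Uu_zero]

lemma sl_gen (P : SL2 F → Prop) (hU : ∀ b, P (Uu b)) (hW : P (Ww F))
    (hm : ∀ X Y, P X → P Y → P (X * Y)) (hi : ∀ X, P X → P X⁻¹) (X : SL2 F) : P X := by
  have key : ∀ X : SL2 F, X 1 0 ≠ 0 → P X := by
    intro X hc
    have hd := sl_det X
    have : X = Uu ((X 0 0 - 1) / X 1 0) * (Ww F * Uu (- X 1 0) * (Ww F)⁻¹) *
        Uu ((X 1 1 - 1) / X 1 0) := by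
      have e : (Ww F)⁻¹ = - Ww F := by
        rw [inv_eq_iff_mul_eq_one]
        apply sl_ext <;> simp [sl_mul_apply, sl_neg_apply, -Matrix.SpecialLinearGroup.coe_mul, -Matrix.SpecialLinearGroup.coe_neg]
      rw [e]
      apply sl_ext <;> simp [sl_mul_apply, sl_neg_apply, -Matrix.SpecialLinearGroup.coe_mul, -Matrix.SpecialLinearGroup.coe_neg] <;> field_simp
      · ring
      · linear_combination -hd
      · ring
    rw [this]
    exact hm _ _ (hm _ _ (hU _) (hm _ _ (hm _ _ hW (hU _)) (hi _ hW))) (hU _)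
  by_cases hc : X 1 0 = 0
  · have hd := sl_det X
    have : X = (Ww F)⁻¹ * (Ww F * X) := by group
    rw [this]
    refine hm _ _ (hi _ hW) (key _ ?_)
    simp [sl_mul_apply, sl_neg_apply, -Matrix.SpecialLinearGroup.coe_mul, -Matrix.SpecialLinearGroup.coe_neg]
    intro h
    rw [h, hc] at hd
    simp at hd
  · exact key X hc

end Aut

section Surj
open Matrix
set_option linter.unusedSectionVars false
set_option linter.unusedSimpArgs false

variable {F : Type*} [Field F] [Fintype F] [DecidableEq F]

lemma sl_one_apply' (i j : Fin 2) : (1 : SL2 F) i j = if i = j then 1 else 0 := by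
  rw [Matrix.SpecialLinearGroup.coe_one, Matrix.one_apply]

lemma slAct_eq {γ : GamL F} {X Y : SL2 F}
    (h : ∀ i j, Y i 0 * γ.left 0 j + Y i 1 * γ.left 1 j =
      γ.left i 0 * γ.right (X 0 j) + γ.left i 1 * γ.right (X 1 j)) :
    slAct F γ X = Y := by
  have h1 := slAct_rel γ X
  have h2 : Matrix.SpecialLinearGroup.toGL Y * γ.left =
      γ.left * glAut F γ.right (Matrix.SpecialLinearGroup.toGL X) := by
    apply Matrix.GeneralLinearGroup.ext
    intro i j
    rw [gl_mul_apply, gl_mul_apply, glAut_apply, glAut_apply]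
    exact h i j
  rw [← h2] at h1
  exact Matrix.SpecialLinearGroup.toGL_injective (mul_right_cancel h1)

lemma slAct_ent (γ : GamL F) (X : SL2 F) (i j : Fin 2) :
    (slAct F γ X) i 0 * γ.left 0 j + (slAct F γ X) i 1 * γ.left 1 j =
      γ.left i 0 * γ.right (X 0 j) + γ.left i 1 * γ.right (X 1 j) := by
  have h1 := slAct_rel γ X
  have h2 : (Matrix.SpecialLinearGroup.toGL (slAct F γ X) * γ.left) i j =
      (γ.left * glAut F γ.right (Matrix.SpecialLinearGroup.toGL X)) i j := by rw [h1]
  rw [gl_mul_apply, gl_mul_apply, glAut_apply, glAut_apply] at h2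
  exact h2

lemma trace_three [CharP F 3] (X : SL2 F) (h3 : mkP F X ^ 3 = 1) (h1 : mkP F X ≠ 1) :
    (X 0 0 + X 1 1) = 1 ∨ (X 0 0 + X 1 1) = -1 := by
  have hd := sl_det X
  have hc : X * X * X = 1 ∨ X * X * X = -1 := by
    rw [← mkP_eq_one_iff, map_mul, map_mul, ← h3, pow_three']
  have e01 : (X * X * X) 0 1 = ((X 0 0 + X 1 1) ^ 2 - 1) * X 0 1 := by
    simp only [sl_mul_apply]; linear_combination (-X 0 1) * hd
  have e10 : (X * X * X) 1 0 = ((X 0 0 + X 1 1) ^ 2 - 1) * X 1 0 := by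
    simp only [sl_mul_apply]; linear_combination (-X 1 0) * hd
  have ed : (X * X * X) 0 0 - (X * X * X) 1 1 =
      ((X 0 0 + X 1 1) ^ 2 - 1) * (X 0 0 - X 1 1) := by
    simp only [sl_mul_apply]; linear_combination (X 1 1 - X 0 0) * hd
  have z01 : (X * X * X) 0 1 = 0 := by
    rcases hc with h | h <;> rw [h] <;> simp [sl_one_apply', sl_neg_apply]
  have z10 : (X * X * X) 1 0 = 0 := by
    rcases hc with h | h <;> rw [h] <;> simp [sl_one_apply', sl_neg_apply]
  have zd : (X * X * X) 0 0 - (X * X * X) 1 1 = 0 := by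
    rcases hc with h | h <;> rw [h] <;> simp [sl_one_apply', sl_neg_apply]
  by_cases ht : (X 0 0 + X 1 1) ^ 2 - 1 = 0
  · exact sq_eq_one_iff.1 (sub_eq_zero.1 ht)
  · exfalso
    apply h1
    have a01 : X 0 1 = 0 := by
      rw [e01] at z01; exact (mul_eq_zero.1 z01).resolve_left ht
    have a10 : X 1 0 = 0 := by
      rw [e10] at z10; exact (mul_eq_zero.1 z10).resolve_left ht
    have ad : X 0 0 = X 1 1 := by
      rw [ed] at zd; exact sub_eq_zero.1 ((mul_eq_zero.1 zd).resolve_left ht)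
    rw [mkP_eq_one_iff]
    rw [a01, ad] at hd
    have : (X 1 1) ^ 2 = 1 := by linear_combination hd
    rcases sq_eq_one_iff.1 this with h | h
    · left; apply sl_ext <;> simp [a01, a10, ad, h, sl_one_apply']
    · right; apply sl_ext <;> simp [a01, a10, ad, h, sl_one_apply', sl_neg_apply]

lemma one_ne_neg_one [CharP F 3] : (1 : F) ≠ -1 := by
  intro h
  have h3 : (3 : F) = 0 := by exact_mod_cast CharP.cast_eq_zero F 3
  have : (1 : F) = 0 := by linear_combination h3 - h
  exact one_ne_zero this

lemma eq_zero_of_neg [CharP F 3] {a : F} (h : a = -a) : a = 0 := by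
  have h3 : (3 : F) = 0 := by exact_mod_cast CharP.cast_eq_zero F 3
  linear_combination a * h3 - h

lemma mkU_inj [CharP F 3] {a b : F} (h : mkP F (Uu a) = mkP F (Uu b)) : a = b := by
  rw [mkP_eq_iff] at h
  rcases h with h | h
  · have := congrArg (fun X : SL2 F => X 0 1) h
    simpa using this
  · have := congrArg (fun X : SL2 F => X 0 0) h
    simp only [sl_neg_apply, Uu00] at this
    exact absurd this one_ne_neg_one

lemma surj5 (α : MulAut (PSL2 F)) (hU : ∀ b, α (mkP F (Uu b)) = mkP F (Uu b))
    (hW : α (mkP F (Ww F)) = mkP F (Ww F)) : α = 1 := by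
  ext x
  obtain ⟨X, rfl⟩ := mkP_surj x
  refine sl_gen (fun X => α (mkP F X) = mkP F X) hU hW ?_ ?_ X
  · intro X Y h1 h2
    rw [map_mul, map_mul, h1, h2]
  · intro X h1
    rw [map_inv, map_inv, h1]

lemma mkU_three [CharP F 3] (b : F) : mkP F (Uu b) ^ 3 = 1 := by
  have h3 : (3 : F) = 0 := by exact_mod_cast CharP.cast_eq_zero F 3
  have : Uu b * Uu b * Uu b = 1 := by
    rw [← Uu_add, ← Uu_add, ← Uu_zero]; congr 1; linear_combination b * h3
  rw [← map_one (mkP F), ← this, map_mul, map_mul, pow_three']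

lemma mkWU_three [CharP F 3] : mkP F (Ww F * Uu 1) ^ 3 = 1 := by
  have : mkP F (Ww F * Uu 1 * (Ww F * Uu 1) * (Ww F * Uu 1)) = 1 := by
    rw [mkP_eq_one_iff]
    right
    apply sl_ext <;> simp only [sl_mul_apply, sl_neg_apply, sl_one_apply', Uu00, Uu01, Uu10, Uu11,
      Ww00, Ww01, Ww10, Ww11] <;> simp
  rw [pow_three', ← map_mul, ← map_mul, this]

lemma surj4a [CharP F 3] (α : MulAut (PSL2 F)) (hU : ∀ b, α (mkP F (Uu b)) = mkP F (Uu b))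
    (Y : SL2 F) (hY : α (mkP F (Ww F)) = mkP F Y) (h0 : Y 0 0 = 0) : α = 1 := by
  apply surj5 α hU
  rw [hY]
  have hd := sl_det Y
  have hb : Y 0 1 ≠ 0 := by intro h; rw [h, h0] at hd; simp at hd
  have hc : Y 1 0 ≠ 0 := by intro h; rw [h, h0] at hd; simp at hd
  have hd1 : Y 1 1 = 0 := by
    have h1 : mkP F (Ww F * Ww F) = 1 := by
      rw [mkP_eq_one_iff]
      right
      apply sl_ext <;> simp only [sl_mul_apply, sl_neg_apply, sl_one_apply',
        Ww00, Ww01, Ww10, Ww11] <;> simp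
    have h2 : mkP F (Y * Y) = 1 := by
      rw [map_mul, ← hY, ← map_mul, ← map_mul, h1, map_one]
    rw [mkP_eq_one_iff] at h2
    have : (Y * Y) 0 1 = 0 := by
      rcases h2 with h | h <;> rw [h] <;> simp [sl_one_apply', sl_neg_apply]
    rw [sl_mul_apply, h0, zero_mul, zero_add] at this
    exact (mul_eq_zero.1 this).resolve_left hb
  have h3 : mkP F (Y * Uu 1) ^ 3 = 1 := by
    have : mkP F (Y * Uu 1) = α (mkP F (Ww F * Uu 1)) := by
      rw [map_mul, map_mul, map_mul, hY, hU]
    rw [this, ← map_pow, mkWU_three, map_one]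
  have hn : mkP F (Y * Uu 1) ≠ 1 := by
    rw [Ne, mkP_eq_one_iff]
    rintro (h | h) <;> have := congrArg (fun X : SL2 F => X 1 0) h <;>
      simp only [sl_mul_apply, sl_neg_apply, sl_one_apply', Uu00, Uu10] at this <;>
      simp [hc] at this
  have := trace_three _ h3 hn
  simp only [sl_mul_apply, Uu00, Uu01, Uu10, Uu11, h0, hd1] at this
  simp only [mul_zero, mul_one, add_zero, zero_add, h0, zero_mul, zero_sub] at this hd
  rw [mkP_eq_iff]
  rcases this with h | h
  · left
    rw [h] at hd
    apply sl_ext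
    · simp [h0]
    · rw [Ww01]; linear_combination -hd
    · simp [h]
    · simp [hd1]
  · right
    rw [h] at hd
    apply sl_ext <;> rw [sl_neg_apply]
    · simp [h0]
    · rw [Ww01]; linear_combination hd
    · simp [h]
    · simp [hd1]

lemma Phi_iota (X Z : SL2 F) : Phi F (iotaSL F X) (mkP F Z) = mkP F (X * Z * X⁻¹) := by
  rw [Phi_mk]
  congr 1
  apply iotaSL_inj
  rw [iota_slAct]
  simp

lemma surj4 [CharP F 3] (α : MulAut (PSL2 F)) (hU : ∀ b, α (mkP F (Uu b)) = mkP F (Uu b)) :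
    ∃ γ, Phi F γ = α := by
  obtain ⟨Y, hY⟩ := mkP_surj (α (mkP F (Ww F)))
  have hd := sl_det Y
  have hc : Y 1 0 ≠ 0 := by
    intro hc
    have e1 : Y * Uu 1 = Uu (Y 0 0 ^ 2) * Y := by
      rw [hc] at hd
      apply sl_ext <;> simp only [sl_mul_apply, Uu00, Uu01, Uu10, Uu11, hc]
      · ring
      · linear_combination (-Y 0 0) * hd
      · ring
      · ring
    have e2 : α (mkP F (Ww F * Uu 1)) = α (mkP F (Uu (Y 0 0 ^ 2) * Ww F)) := by
      rw [map_mul, map_mul, hU, ← hY, ← map_mul, e1, map_mul, map_mul, map_mul, hU, hY]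
    have e3 := α.injective e2
    rw [mkP_eq_iff] at e3
    rcases e3 with h | h <;> have := congrArg (fun X : SL2 F => X 1 1) h <;>
      simp only [sl_mul_apply, sl_neg_apply, Uu00, Uu10, Uu01, Uu11, Ww00, Ww01, Ww10, Ww11]
        at this <;> simp at this
  set r := - Y 0 0 / Y 1 0 with hr
  refine ⟨(iotaSL F (Uu r))⁻¹, ?_⟩
  have : Phi F (iotaSL F (Uu r)) * α = 1 := by
    apply surj4a _ _ (Uu r * Y * (Uu r)⁻¹)
    · rw [MulAut.mul_apply, ← hY, Phi_iota]
    · rw [← Uu_neg]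
      simp only [sl_mul_apply, Uu00, Uu10, Uu01, Uu11]
      rw [hr]; field_simp; ring
    · intro b
      rw [MulAut.mul_apply, hU, Phi_iota, ← Uu_neg, ← Uu_add, ← Uu_add]
      congr 2
      ring
  rw [map_inv]
  exact inv_eq_of_mul_eq_one_right this

lemma comm_U1 [CharP F 3] (Y : SL2 F) (h : mkP F (Y * Uu 1) = mkP F (Uu 1 * Y)) :
    ∃ b, mkP F Y = mkP F (Uu b) := by
  have hd := sl_det Y
  rw [mkP_eq_iff] at h
  rcases h with h | h
  · have h00 := congrArg (fun X : SL2 F => X 0 0) h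
    have h01 := congrArg (fun X : SL2 F => X 0 1) h
    simp only [sl_mul_apply, sl_neg_apply, Uu00, Uu10, Uu01, Uu11] at h00 h01
    have hc : Y 1 0 = 0 := by linear_combination -h00
    have ha : Y 0 0 = Y 1 1 := by linear_combination h01
    rw [hc, ha] at hd
    have : (Y 1 1) ^ 2 = 1 := by linear_combination hd
    rcases sq_eq_one_iff.1 this with h | h
    · exact ⟨Y 0 1, by rw [mkP_eq_iff]; left; apply sl_ext <;> simp [hc, ha, h]⟩
    · refine ⟨- Y 0 1, ?_⟩
      rw [mkP_eq_iff]; right; apply sl_ext <;> rw [sl_neg_apply] <;> simp [hc, ha, h]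
  · exfalso
    have h00 := congrArg (fun X : SL2 F => X 0 0) h
    have h10 := congrArg (fun X : SL2 F => X 1 0) h
    simp only [sl_mul_apply, sl_neg_apply, Uu00, Uu10, Uu01, Uu11] at h00 h10
    have hc : Y 1 0 = 0 := eq_zero_of_neg (by linear_combination h10)
    have ha : Y 0 0 = 0 := eq_zero_of_neg (by linear_combination h00 - hc)
    rw [hc, ha] at hd
    simp at hd

lemma norm_U [CharP F 3] (Y : SL2 F) (u v : F) (hu : u ≠ 0)
    (h : mkP F (Y * Uu u) = mkP F (Uu v * Y)) : v = Y 0 0 ^ 2 * u := by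
  have hd := sl_det Y
  rw [mkP_eq_iff] at h
  rcases h with h | h
  · have h11 := congrArg (fun X : SL2 F => X 1 1) h
    have h01 := congrArg (fun X : SL2 F => X 0 1) h
    simp only [sl_mul_apply, sl_neg_apply, Uu00, Uu10, Uu01, Uu11] at h11 h01
    have hc : Y 1 0 = 0 := by
      have : Y 1 0 * u = 0 := by linear_combination h11
      exact (mul_eq_zero.1 this).resolve_right hu
    rw [hc] at hd
    linear_combination (-Y 0 0) * h01 - v * hd
  · exfalso
    have h00 := congrArg (fun X : SL2 F => X 0 0) h
    have h10 := congrArg (fun X : SL2 F => X 1 0) h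
    simp only [sl_mul_apply, sl_neg_apply, Uu00, Uu10, Uu01, Uu11] at h00 h10
    have hc : Y 1 0 = 0 := eq_zero_of_neg (by linear_combination h10)
    have ha : Y 0 0 = 0 := eq_zero_of_neg (by linear_combination h00 - v * hc)
    rw [hc, ha] at hd
    simp at hd

lemma surj3 [CharP F 3] (hs : ∀ a : F, IsSquare a ∨ IsSquare (-a))
    (α : MulAut (PSL2 F)) (h1 : α (mkP F (Uu 1)) = mkP F (Uu 1)) :
    ∃ γ, Phi F γ = α := by
  have hβ : ∀ b, ∃ b', α (mkP F (Uu b)) = mkP F (Uu b') := by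
    intro b
    obtain ⟨Y, hY⟩ := mkP_surj (α (mkP F (Uu b)))
    rw [← hY]
    apply comm_U1
    rw [map_mul, map_mul, hY, ← h1, ← map_mul, ← map_mul, ← map_mul, ← map_mul, ← Uu_add,
      ← Uu_add, add_comm]
  choose β hβ using hβ
  have hadd : ∀ a b, β (a + b) = β a + β b := by
    intro a b
    apply mkU_inj
    rw [← hβ, Uu_add, Uu_add, map_mul, map_mul, map_mul, hβ, hβ]
  have hinj : Function.Injective β := by
    intro a b h
    apply mkU_inj
    apply α.injective
    rw [hβ, hβ, h]
  have hone : β 1 = 1 := by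
    apply mkU_inj
    rw [← hβ, h1]
  have hzero : β 0 = 0 := by
    have := hadd 0 0
    rw [add_zero] at this
    linear_combination -this
  have hneg : ∀ a, β (-a) = - β a := by
    intro a
    have := hadd a (-a)
    rw [add_neg_cancel, hzero] at this
    linear_combination -this
  have hsqm : ∀ t b, β (t * t * b) = β (t * t) * β b := by
    intro t b
    by_cases ht : t = 0
    · simp [ht, hzero]
    obtain ⟨Y, hY⟩ := mkP_surj (α (mkP F (Dd t ht)))
    have key : ∀ b, β (t * t * b) = Y 0 0 ^ 2 * β b := by
      intro b
      by_cases hb : b = 0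
      · simp [hb, hzero]
      apply norm_U
      · intro h; apply hb; apply hinj; rw [h, hzero]
      · rw [map_mul, map_mul, ← hβ, ← hβ, hY, ← map_mul, ← map_mul, ← map_mul, ← map_mul]
        congr 2
        apply sl_ext <;> simp only [sl_mul_apply, Uu00, Uu10, Uu01, Uu11, Dd00, Dd01, Dd10, Dd11]
        · ring
        · field_simp; ring
        · ring
        · ring
    have := key 1
    rw [mul_one, hone, mul_one] at this
    rw [key, this]
  have hmul : ∀ a b, β (a * b) = β a * β b := by
    intro a b
    rcases hs a with ⟨t, ht⟩ | ⟨t, ht⟩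
    · rw [ht, hsqm]
    · have : a = -(t * t) := by rw [← ht, neg_neg]
      rw [this, neg_mul, hneg, hneg, hsqm, neg_mul]
  let βh : F →+* F :=
    { toFun := β, map_one' := hone, map_mul' := hmul, map_zero' := hzero, map_add' := hadd }
  let σ : RingAut F := RingEquiv.ofBijective βh (Finite.injective_iff_bijective.1 hinj)
  have hσ : ∀ b, σ b = β b := fun b => rfl
  obtain ⟨γ, hγ⟩ := surj4 ((Phi F (SemidirectProduct.inr σ))⁻¹ * α) (by
    intro b
    rw [MulAut.mul_apply, hβ]
    rw [MulAut.inv_apply, MulEquiv.symm_apply_eq, Phi_mk]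
    congr 1
    symm
    apply slAct_eq
    intro i j
    fin_cases i <;> fin_cases j <;> simp [hσ, hone, hzero])
  refine ⟨SemidirectProduct.inr σ * γ, ?_⟩
  rw [map_mul, hγ, mul_inv_cancel_left]

theorem Phi_surj [CharP F 3] (hs : ∀ a : F, IsSquare a ∨ IsSquare (-a)) :
    Function.Surjective (Phi F) := by
  intro α
  have h3 : (3 : F) = 0 := by exact_mod_cast CharP.cast_eq_zero F 3
  obtain ⟨Y0, hY0⟩ := mkP_surj (α (mkP F (Uu 1)))
  have hone : mkP F (Uu (1 : F)) ≠ 1 := by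
    rw [← map_one (mkP F), ← Uu_zero]
    intro h
    exact one_ne_zero (mkU_inj h)
  have hn : mkP F Y0 ≠ 1 := by
    rw [hY0]
    intro h
    apply hone
    apply α.injective
    rw [h, map_one]
  have hY : ∃ Y : SL2 F, mkP F Y = α (mkP F (Uu 1)) ∧ Y 0 0 + Y 1 1 = -1 := by
    rcases trace_three Y0 (by rw [hY0, ← map_pow, mkU_three, map_one]) hn with h | h
    · refine ⟨-Y0, ?_, ?_⟩
      · rw [← hY0, mkP_eq_iff]; right; rfl
      · rw [sl_neg_apply, sl_neg_apply]; linear_combination -h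
    · exact ⟨Y0, hY0, h⟩
  obtain ⟨Y, hY, ht⟩ := hY
  have hd := sl_det Y
  have main : ∃ g : GL (Fin 2) F, Phi F (SemidirectProduct.inl g) (mkP F (Uu 1)) = mkP F Y := by
    by_cases hc : Y 1 0 = 0
    · have ha : Y 0 0 = 1 := by
        have h11 : Y 1 1 = -1 - Y 0 0 := by linear_combination ht
        rw [hc, h11] at hd
        have : (Y 0 0 - 1) ^ 2 = 0 := by linear_combination -hd - (Y 0 0) * h3
        exact sub_eq_zero.1 (pow_eq_zero_iff (two_ne_zero) |>.1 this)
      have h11 : Y 1 1 = 1 := by linear_combination ht - ha - h3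
      have hm : Y 0 1 ≠ 0 := by
        intro hm
        apply hn
        rw [hY0, ← hY, mkP_eq_one_iff]
        left
        apply sl_ext <;> simp [hc, ha, h11, hm]
      refine ⟨mkGL (Y 0 1) 0 0 1 (by simpa using hm), ?_⟩
      rw [Phi_mk]
      congr 1
      apply slAct_eq
      intro i j
      fin_cases i <;> fin_cases j <;> simp [hc, ha, h11]
    · refine ⟨mkGL (Y 0 0 - 1) 1 (Y 1 0) 0 (by simpa using hc), ?_⟩
      rw [Phi_mk]
      congr 1
      apply slAct_eq
      intro i j
      have h11 : Y 1 1 = -1 - Y 0 0 := by linear_combination ht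
      rw [h11] at hd
      fin_cases i <;> fin_cases j <;> simp [h11]
      · linear_combination -hd - (Y 0 0) * h3
      · linear_combination (-Y 1 0) * h3
  obtain ⟨g, hg⟩ := main
  obtain ⟨γ, hγ⟩ := surj3 hs ((Phi F (SemidirectProduct.inl g))⁻¹ * α) (by
    rw [MulAut.mul_apply, MulAut.inv_apply, MulEquiv.symm_apply_eq, hg, hY])
  refine ⟨SemidirectProduct.inl g * γ, ?_⟩
  rw [map_mul, hγ, mul_inv_cancel_left]

end Surj

section RepG
open Matrix Finset
set_option linter.unusedSectionVars false
set_option linter.unusedSimpArgs false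

variable {F : Type*} [Field F] [Fintype F] [DecidableEq F]

lemma isSquare_aut (σ : RingAut F) (a : F) : IsSquare (σ a) ↔ IsSquare a := by
  constructor
  · rintro ⟨r, hr⟩
    refine ⟨σ.symm r, ?_⟩
    rw [← map_mul, ← hr]; simp
  · rintro ⟨r, hr⟩
    exact ⟨σ r, by rw [← map_mul, ← hr]⟩

lemma qch_aut (σ : RingAut F) (a : F) : qch F (σ a) = qch F a := by
  rw [qch_apply, qch_apply]
  congr 1
  rw [quadraticChar_apply, quadraticChar_apply, quadraticCharFun, quadraticCharFun]
  simp only [isSquare_aut, EmbeddingLike.map_eq_zero_iff]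

lemma bes_aut (ψ : AddChar F ℂ) (hA : ∀ (σ : RingAut F) x, ψ (σ x) = ψ x) (σ : RingAut F) (v : F) :
    bes ψ (σ v) = bes ψ v := by
  unfold bes
  congr 1
  rw [← Equiv.sum_comp σ.toEquiv]
  refine Finset.sum_congr rfl fun s _ => ?_
  change (if (σ s) ^ 2 = σ v then qch F (σ s) * ψ (σ s) else 0) = _
  rw [← map_pow, qch_aut, hA]
  simp only [EmbeddingLike.apply_eq_iff_eq]

/-- action on units -/
def uAut (σ : RingAut F) : Fˣ ≃ Fˣ := (Units.mapEquiv σ.toMulEquiv).toEquiv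

@[simp] lemma uAut_coe (σ : RingAut F) (x : Fˣ) : ((uAut σ x : Fˣ) : F) = σ x := rfl

lemma kir_aut (ψ : AddChar F ℂ) (hA : ∀ (σ : RingAut F) x, ψ (σ x) = ψ x) (σ : RingAut F)
    (g : GL (Fin 2) F) (x z : Fˣ) : kir ψ (glAut F σ g) (uAut σ x) (uAut σ z) = kir ψ g x z := by
  unfold kir
  simp only [glAut_apply, uAut_coe, EmbeddingLike.map_eq_zero_iff, ← map_mul, ← map_div₀,
    ← map_add, ← map_sub, ← map_pow, hA, bes_aut ψ hA, EmbeddingLike.apply_eq_iff_eq]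

/-- The representation of `ΓL₂`. -/
noncomputable def RR [CharP F 3] (hsq : ¬ IsSquare (-1 : F)) (ψ : AddChar F ℂ) (hψ : ψ ≠ 1)
    (hA : ∀ (σ : RingAut F) x, ψ (σ x) = ψ x) : GamL F →* Matrix Fˣ Fˣ ℂ where
  toFun γ := Matrix.of fun x z => kir ψ γ.left x (uAut γ.right z)
  map_one' := by
    ext x z
    change kir ψ 1 x z = _
    rw [kir_one]
  map_mul' := fun γ δ => by
    ext x z
    rw [Matrix.mul_apply]
    change kir ψ (γ.left * glAut F γ.right δ.left) x (uAut γ.right (uAut δ.right z)) = _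
    rw [kir_mul hsq ψ hψ, Matrix.mul_apply, ← Equiv.sum_comp (uAut γ.right)]
    refine Finset.sum_congr rfl fun y _ => ?_
    rw [kir_aut ψ hA]
    rfl

lemma RR_apply [CharP F 3] (hsq : ¬ IsSquare (-1 : F)) (ψ : AddChar F ℂ) (hψ : ψ ≠ 1)
    (hA : ∀ (σ : RingAut F) x, ψ (σ x) = ψ x) (γ : GamL F) (x z : Fˣ) :
    RR hsq ψ hψ hA γ x z = kir ψ γ.left x (uAut γ.right z) := rfl

lemma Phi_ker [CharP F 3] (γ : GamL F) (h : Phi F γ = 1) : γ.right = 1 ∧ γ.left 1 0 = 0 ∧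
    γ.left 0 1 = 0 ∧ γ.left 0 0 = γ.left 1 1 := by
  have hd := gl_det_ne γ.left
  have key : ∀ X : SL2 F, slAct F γ X = X ∨ slAct F γ X = -X := by
    intro X
    rw [← mkP_eq_iff, ← Phi_mk, h]; rfl
  have hU : ∀ t, γ.left 1 0 = 0 ∧ t * γ.left 1 1 = γ.left 0 0 * γ.right t := by
    have e : ∀ t, t ≠ 0 → γ.left 1 0 = 0 ∧ t * γ.left 1 1 = γ.left 0 0 * γ.right t := by
      intro t ht
      have h00 := slAct_ent γ (Uu t) 0 0
      have h01 := slAct_ent γ (Uu t) 0 1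
      have h10 := slAct_ent γ (Uu t) 1 0
      rcases key (Uu t) with k | k <;> rw [k] at h00 h01 h10 <;>
        simp only [sl_neg_apply, Uu00, Uu01, Uu10, Uu11, map_one, map_zero] at h00 h01 h10
      · constructor
        · have : t * γ.left 1 0 = 0 := by linear_combination h00
          exact (mul_eq_zero.1 this).resolve_left ht
        · linear_combination h01
      · exfalso
        have hc : γ.left 1 0 = 0 := eq_zero_of_neg (by linear_combination -h10)
        have ha : γ.left 0 0 = 0 := eq_zero_of_neg (by linear_combination -h00 - t * hc)
        rw [hc, ha] at hd
        simp at hd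
    intro t
    by_cases ht : t = 0
    · exact ⟨(e 1 one_ne_zero).1, by simp [ht]⟩
    · exact e t ht
  have hc := (hU 1).1
  have ha : γ.left 0 0 = γ.left 1 1 := by
    have := (hU 1).2
    rw [map_one] at this
    linear_combination -this
  have hb : γ.left 0 1 = 0 := by
    have h00 := slAct_ent γ (Ww F) 0 0
    rcases key (Ww F) with k | k <;> rw [k] at h00 <;>
      simp only [sl_neg_apply, Ww00, Ww01, Ww10, Ww11, map_one, map_zero] at h00
    · linear_combination -h00 - hc
    · linear_combination -h00 + hc
  refine ⟨?_, hc, hb, ha⟩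
  ext t
  have := (hU t).2
  rw [ha] at this
  have hd1 : γ.left 1 1 ≠ 0 := by
    intro h0; rw [h0, hc] at hd; simp at hd
  have : γ.left 1 1 * (γ.right t - t) = 0 := by linear_combination -this
  exact sub_eq_zero.1 ((mul_eq_zero.1 this).resolve_left hd1)

lemma RR_ker [CharP F 3] (hsq : ¬ IsSquare (-1 : F)) (ψ : AddChar F ℂ) (hψ : ψ ≠ 1)
    (hA : ∀ (σ : RingAut F) x, ψ (σ x) = ψ x) (γ : GamL F) (h : Phi F γ = 1) :
    RR hsq ψ hψ hA γ = 1 := by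
  obtain ⟨h1, h2, h3, h4⟩ := Phi_ker γ h
  have hd := gl_det_ne γ.left
  have hd1 : γ.left 1 1 ≠ 0 := by
    intro h0; rw [h0, h2] at hd; simp at hd
  ext x z
  rw [RR_apply]
  have : uAut γ.right z = z := by rw [h1]; rfl
  rw [this, kir, if_pos h2, h3, h4, Matrix.one_apply]
  have e : ((z : F) * γ.left 1 1 = γ.left 1 1 * x) ↔ x = z := by
    rw [mul_comm, mul_right_inj' hd1, Units.val_inj, eq_comm]
  simp [e]

lemma RR_congr [CharP F 3] (hsq : ¬ IsSquare (-1 : F)) (ψ : AddChar F ℂ) (hψ : ψ ≠ 1)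
    (hA : ∀ (σ : RingAut F) x, ψ (σ x) = ψ x) (γ δ : GamL F) (h : Phi F γ = Phi F δ) :
    RR hsq ψ hψ hA γ = RR hsq ψ hψ hA δ := by
  have : RR hsq ψ hψ hA (δ⁻¹ * γ) = 1 := by
    apply RR_ker
    rw [map_mul, map_inv, h, inv_mul_cancel]
  calc RR hsq ψ hψ hA γ = RR hsq ψ hψ hA (δ * (δ⁻¹ * γ)) := by rw [mul_inv_cancel_left]
    _ = _ := by rw [map_mul, this, mul_one]

/-- The representation of `Aut(PSL₂)`. -/
noncomputable def RA [CharP F 3] (hsq : ¬ IsSquare (-1 : F)) (ψ : AddChar F ℂ) (hψ : ψ ≠ 1)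
    (hA : ∀ (σ : RingAut F) x, ψ (σ x) = ψ x) : MulAut (PSL2 F) →* Matrix Fˣ Fˣ ℂ where
  toFun α := RR hsq ψ hψ hA (Function.surjInv (Phi_surj (isSquare_or_neg hsq)) α)
  map_one' := by
    rw [← map_one (RR hsq ψ hψ hA)]
    apply RR_congr
    rw [Function.surjInv_eq (Phi_surj (isSquare_or_neg hsq)), map_one]
  map_mul' := fun α β => by
    rw [← map_mul]
    apply RR_congr
    rw [map_mul, Function.surjInv_eq (Phi_surj (isSquare_or_neg hsq)), Function.surjInv_eq (Phi_surj (isSquare_or_neg hsq)), Function.surjInv_eq (Phi_surj (isSquare_or_neg hsq))]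

lemma RA_Phi [CharP F 3] (hsq : ¬ IsSquare (-1 : F)) (ψ : AddChar F ℂ) (hψ : ψ ≠ 1)
    (hA : ∀ (σ : RingAut F) x, ψ (σ x) = ψ x) (γ : GamL F) :
    RA hsq ψ hψ hA (Phi F γ) = RR hsq ψ hψ hA γ := by
  change RR hsq ψ hψ hA (Function.surjInv (Phi_surj (isSquare_or_neg hsq)) (Phi F γ)) = _
  apply RR_congr
  rw [Function.surjInv_eq (Phi_surj (isSquare_or_neg hsq))]

/-- A primitive cube root of unity. -/
noncomputable def om : ℂ := ⟨-1/2, Real.sqrt 3 / 2⟩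

lemma om_sq : om * om = -1 - om := by
  have h : Real.sqrt 3 * Real.sqrt 3 = 3 := Real.mul_self_sqrt (by norm_num)
  apply Complex.ext
  · simp [om]; nlinarith
  · simp [om]; ring

/-- The field of cube roots of unity, as a subring -/
noncomputable def KK : Subring ℂ where
  carrier := {z | ∃ a b : ℚ, z = a + b * om}
  one_mem' := ⟨1, 0, by simp⟩
  zero_mem' := ⟨0, 0, by simp⟩
  add_mem' := by
    rintro _ _ ⟨a, b, rfl⟩ ⟨c, d, rfl⟩
    exact ⟨a + c, b + d, by push_cast; ring⟩
  neg_mem' := by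
    rintro _ ⟨a, b, rfl⟩
    exact ⟨-a, -b, by push_cast; ring⟩
  mul_mem' := by
    rintro _ _ ⟨a, b, rfl⟩ ⟨c, d, rfl⟩
    exact ⟨a * c - b * d, a * d + b * c - b * d, by
      push_cast; linear_combination ((b : ℂ) * d) * om_sq⟩

lemma KK_rat (q : ℚ) : (q : ℂ) ∈ KK := ⟨q, 0, by simp⟩

lemma KK_real {z : ℂ} (hz : z ∈ KK) (hc : (starRingEnd ℂ) z = z) : ∃ q : ℚ, z = q := by
  obtain ⟨a, b, rfl⟩ := hz
  refine ⟨a, ?_⟩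
  have := congrArg Complex.im hc
  simp [om] at this
  have h3 : Real.sqrt 3 ≠ 0 := by positivity
  have hb : (b : ℝ) = 0 := by
    by_contra hb
    apply hb
    have : (b : ℝ) * Real.sqrt 3 = 0 := by linarith
    exact (mul_eq_zero.1 this).resolve_right h3
  have hb' : b = 0 := by exact_mod_cast hb
  simp [hb']

lemma psi_mem [CharP F 3] (ψ : AddChar F ℂ) (x : F) : ψ x ∈ KK := by
  have h3 : (3 : F) = 0 := by exact_mod_cast CharP.cast_eq_zero F 3
  have h : ψ x * ψ x * ψ x = 1 := by
    rw [← AddChar.map_add_eq_mul, ← AddChar.map_add_eq_mul, ← AddChar.map_zero_eq_one ψ]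
    congr 1; linear_combination x * h3
  have h2 : (ψ x - 1) * ((ψ x - om) * (ψ x + 1 + om)) = 0 := by
    linear_combination h - (ψ x - 1) * om_sq
  rcases mul_eq_zero.1 h2 with h | h
  · exact ⟨1, 0, by simp; linear_combination h⟩
  rcases mul_eq_zero.1 h with h | h
  · exact ⟨0, 1, by simp; linear_combination h⟩
  · exact ⟨-1, -1, by simp; linear_combination h⟩

lemma qch_mem (x : F) : qch F x ∈ KK := by
  rw [qch_apply]
  exact_mod_cast KK_rat ((quadraticChar F x : ℤ) : ℚ)

lemma bes_mem [CharP F 3] (hsq : ¬ IsSquare (-1 : F)) (ψ : AddChar F ℂ) (hψ : ψ ≠ 1) (v : F) :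
    bes ψ v ∈ KK := by
  unfold bes
  apply Subring.mul_mem
  · have hg : gaussSum (qch F) ψ ∈ KK := by
      unfold gaussSum
      exact Subring.sum_mem _ fun s _ => Subring.mul_mem _ (qch_mem s) (psi_mem ψ s)
    have h2 := gauss_sq hsq ψ hψ
    have h0 := gauss_ne hsq ψ hψ
    have hq : (Fintype.card F : ℂ) ≠ 0 := by
      intro h; rw [h, neg_zero] at h2; exact h0 (pow_eq_zero_iff two_ne_zero |>.1 h2)
    have : (gaussSum (qch F) ψ)⁻¹ = ((-(Fintype.card F : ℚ)⁻¹ : ℚ) : ℂ) * gaussSum (qch F) ψ := by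
      push_cast
      field_simp
      linear_combination h2
    rw [this]
    exact Subring.mul_mem _ (KK_rat _) hg
  · apply Subring.sum_mem
    intro s _
    split_ifs
    · exact Subring.mul_mem _ (qch_mem s) (psi_mem ψ s)
    · exact Subring.zero_mem _

lemma kir_mem [CharP F 3] (hsq : ¬ IsSquare (-1 : F)) (ψ : AddChar F ℂ) (hψ : ψ ≠ 1)
    (g : GL (Fin 2) F) (x z : Fˣ) : kir ψ g x z ∈ KK := by
  unfold kir
  split_ifs
  · exact Subring.mul_mem _ (psi_mem ψ _) (Subring.one_mem _)
  · rw [mul_zero]; exact Subring.zero_mem _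
  · exact Subring.mul_mem _ (psi_mem ψ _) (bes_mem hsq ψ hψ _)

lemma conj_psi (ψ : AddChar F ℂ) (x : F) : (starRingEnd ℂ) (ψ x) = ψ (-x) :=
  (AddChar.map_neg_eq_conj ψ x).symm

lemma conj_qch (x : F) : (starRingEnd ℂ) (qch F x) = qch F x := by
  rw [qch_apply]; simp

lemma conj_bes (hsq : ¬ IsSquare (-1 : F)) (ψ : AddChar F ℂ) (v : F) :
    (starRingEnd ℂ) (bes ψ v) = bes ψ v := by
  unfold bes
  have h1 : (starRingEnd ℂ) (gaussSum (qch F) ψ) = - gaussSum (qch F) ψ := by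
    unfold gaussSum
    rw [map_sum, ← Equiv.sum_comp (Equiv.neg F), ← Finset.sum_neg_distrib]
    refine Finset.sum_congr rfl fun s _ => ?_
    rw [map_mul, conj_psi, conj_qch, Equiv.neg_apply, qch_neg hsq, neg_neg, neg_mul]
  have h2 : (starRingEnd ℂ) (∑ s : F, if s ^ 2 = v then qch F s * ψ s else 0) =
      - ∑ s : F, if s ^ 2 = v then qch F s * ψ s else 0 := by
    rw [map_sum, ← Equiv.sum_comp (Equiv.neg F), ← Finset.sum_neg_distrib]
    refine Finset.sum_congr rfl fun s _ => ?_
    rw [Equiv.neg_apply, neg_sq]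
    split_ifs
    · rw [map_mul, conj_psi, conj_qch, qch_neg hsq, neg_neg, neg_mul]
    · simp
  rw [map_mul, map_inv₀, h1, h2, inv_neg, neg_mul_neg]

lemma conj_kir (hsq : ¬ IsSquare (-1 : F)) (ψ : AddChar F ℂ) (g : GL (Fin 2) F) (x z : Fˣ) :
    (starRingEnd ℂ) (kir ψ g x z) = kir ψ g (-x) (-z) := by
  unfold kir
  by_cases hc : g 1 0 = 0
  · rw [if_pos hc, if_pos hc, map_mul, conj_psi]
    simp only [Units.val_neg, mul_neg, neg_mul, neg_inj]
    rw [neg_div]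
    split_ifs <;> simp
  · rw [if_neg hc, if_neg hc, map_mul, conj_psi, conj_bes hsq]
    congr 2
    · simp only [Units.val_neg]; ring
    · simp only [Units.val_neg]; ring

lemma RR_trace_rat [CharP F 3] (hsq : ¬ IsSquare (-1 : F)) (ψ : AddChar F ℂ) (hψ : ψ ≠ 1)
    (hA : ∀ (σ : RingAut F) x, ψ (σ x) = ψ x) (γ : GamL F) :
    ∃ q : ℚ, (RR hsq ψ hψ hA γ).trace = q := by
  apply KK_real
  · unfold Matrix.trace
    exact Subring.sum_mem _ fun x _ => kir_mem hsq ψ hψ _ _ _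
  · unfold Matrix.trace
    rw [map_sum, ← Equiv.sum_comp (Equiv.neg Fˣ)]
    refine Finset.sum_congr rfl fun x _ => ?_
    simp only [Matrix.diag_apply, RR_apply, conj_kir hsq, Equiv.neg_apply, neg_neg]
    congr 1
    ext
    simp

end RepG

section Irr
open Matrix Finset CategoryTheory
set_option linter.unusedSectionVars false
set_option linter.unusedSimpArgs false

lemma kir_U {F : Type*} [Field F] [Fintype F] [DecidableEq F] (ψ : AddChar F ℂ) (b : F) :
    kir ψ (mkGL 1 b 0 1 (by simp)) = Matrix.diagonal fun x : Fˣ => ψ (b * x) := by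
  ext x z
  rw [kir, if_pos (by simp), Matrix.diagonal_apply]
  simp [Units.val_inj, eq_comm]

lemma kir_D {F : Type*} [Field F] [Fintype F] [DecidableEq F] (ψ : AddChar F ℂ) (a : Fˣ)
    (x z : Fˣ) :
    kir ψ (mkGL (a : F) 0 0 1 (by simp)) x z = if z = a * x then 1 else 0 := by
  rw [kir, if_pos (by simp)]
  simp [Units.ext_iff]

lemma comm_scalar {F : Type*} [Field F] [Fintype F] [DecidableEq F] (ψ : AddChar F ℂ) (hψ : ψ ≠ 1)
    (M : Matrix Fˣ Fˣ ℂ) (h : ∀ g : GL (Fin 2) F, kir ψ g * M = M * kir ψ g) :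
    M = M 1 1 • 1 := by
  have hdiag : ∀ x z : Fˣ, x ≠ z → M x z = 0 := by
    intro x z hxz
    by_contra hM
    apply hψ
    have hne : (x : F) - z ≠ 0 := by
      intro h0; exact hxz (Units.ext (sub_eq_zero.1 h0))
    have key : ∀ b : F, ψ (b * (x - z)) = 1 := by
      intro b
      have := congrFun (congrFun (h (mkGL 1 b 0 1 (by simp))) x) z
      rw [kir_U, Matrix.diagonal_mul, Matrix.mul_diagonal, mul_comm] at this
      have e := mul_left_cancel₀ hM this
      have e2 : ψ (b * x) = ψ (b * (x - z)) * ψ (b * z) := by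
        rw [← AddChar.map_add_eq_mul]; congr 1; ring
      rw [e2] at e
      have hz : ψ (b * z) ≠ 0 := by
        intro h0
        have := AddChar.map_add_eq_mul ψ (b * z) (-(b * z))
        rw [add_neg_cancel, AddChar.map_zero_eq_one, h0, zero_mul] at this
        exact one_ne_zero this
      exact mul_right_cancel₀ hz (by rw [e, one_mul])
    ext y
    have := key (y / (x - z))
    rw [div_mul_cancel₀ _ hne] at this
    simpa using this
  have hd : ∀ a : Fˣ, M a a = M 1 1 := by
    intro a
    have := congrFun (congrFun (h (mkGL (a : F) 0 0 1 (by simp))) 1) a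
    rw [Matrix.mul_apply, Matrix.mul_apply] at this
    simp only [kir_D, mul_one] at this
    simp at this
    exact this
  ext x z
  by_cases hxz : x = z
  · subst hxz; simp [hd x]
  · simp [hdiag x z hxz, hxz]

variable {F : Type} [Field F] [Fintype F] [DecidableEq F] [CharP F 3]

/-- The representation of `G`. -/
noncomputable def rhoG (hsq : ¬ IsSquare (-1 : F)) (ψ : AddChar F ℂ) (hψ : ψ ≠ 1)
    (hA : ∀ (σ : RingAut F) x, ψ (σ x) = ψ x) (G : Subgroup (MulAut (PSL2 F))) :
    Representation ℂ G (Fˣ → ℂ) :=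
  ((Matrix.toLinAlgEquiv' : Matrix Fˣ Fˣ ℂ ≃ₐ[ℂ] _) : Matrix Fˣ Fˣ ℂ →* _).comp
    ((RA hsq ψ hψ hA).comp G.subtype)

lemma rhoG_apply (hsq : ¬ IsSquare (-1 : F)) (ψ : AddChar F ℂ) (hψ : ψ ≠ 1)
    (hA : ∀ (σ : RingAut F) x, ψ (σ x) = ψ x) (G : Subgroup (MulAut (PSL2 F))) (g : G) :
    rhoG hsq ψ hψ hA G g = Matrix.toLin' (RA hsq ψ hψ hA g) := rfl

lemma RA_inl (hsq : ¬ IsSquare (-1 : F)) (ψ : AddChar F ℂ) (hψ : ψ ≠ 1)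
    (hA : ∀ (σ : RingAut F) x, ψ (σ x) = ψ x) (g : GL (Fin 2) F) :
    RA hsq ψ hψ hA (Phi F (SemidirectProduct.inl g)) = kir ψ g := by
  rw [RA_Phi]
  rfl

lemma char_eq (hsq : ¬ IsSquare (-1 : F)) (ψ : AddChar F ℂ) (hψ : ψ ≠ 1)
    (hA : ∀ (σ : RingAut F) x, ψ (σ x) = ψ x) (G : Subgroup (MulAut (PSL2 F))) (g : G) :
    (FDRep.of (rhoG hsq ψ hψ hA G)).character g = (RA hsq ψ hψ hA g).trace := by
  unfold FDRep.character
  rw [FDRep.of_ρ']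
  exact Matrix.trace_toLin'_eq _

lemma simpleG (hsq : ¬ IsSquare (-1 : F)) (ψ : AddChar F ℂ) (hψ : ψ ≠ 1)
    (hA : ∀ (σ : RingAut F) x, ψ (σ x) = ψ x) (G : Subgroup (MulAut (PSL2 F)))
    (hG : ∀ g, Phi F (SemidirectProduct.inl g) ∈ G) :
    Simple (FDRep.of (rhoG hsq ψ hψ hA G)) := by
  have : Finite (MulAut (PSL2 F)) := DFunLike.finite _
  have : NeZero (Nat.card G : ℂ) := ⟨by exact_mod_cast Nat.card_pos.ne'⟩
  rw [FDRep.simple_iff_end_is_rank_one]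
  have hne : (𝟙 (FDRep.of (rhoG hsq ψ hψ hA G)) : _ ⟶ _) ≠ 0 := by
    intro h0
    have h1 := congrArg (fun f : FDRep.of (rhoG hsq ψ hψ hA G) ⟶ FDRep.of (rhoG hsq ψ hψ hA G) =>
      f.hom.hom.hom (Pi.single (1 : Fˣ) (1 : ℂ)) 1) h0
    have h2 : (Pi.single (1 : Fˣ) (1 : ℂ) : Fˣ → ℂ) 1 = 0 := h1
    simp at h2
  refine finrank_eq_one (𝟙 _) hne fun f => ?_
  let T : (Fˣ → ℂ) →ₗ[ℂ] (Fˣ → ℂ) := f.hom.hom.hom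
  have hT : ∀ (g : G), T ∘ₗ rhoG hsq ψ hψ hA G g = rhoG hsq ψ hψ hA G g ∘ₗ T := by
    intro g
    have := f.comm g
    have h2 := congrArg (fun k => k.hom.hom) this
    exact h2
  have hM : ∀ g : GL (Fin 2) F, kir ψ g * LinearMap.toMatrix' T = LinearMap.toMatrix' T * kir ψ g := by
    intro g
    have := hT ⟨_, hG g⟩
    rw [rhoG_apply] at this
    simp only [RA_inl] at this
    have h2 := congrArg LinearMap.toMatrix' this
    rw [LinearMap.toMatrix'_comp, LinearMap.toMatrix'_comp, LinearMap.toMatrix'_toLin'] at h2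
    exact h2.symm
  have hs := comm_scalar ψ hψ _ hM
  refine ⟨LinearMap.toMatrix' T 1 1, ?_⟩
  have hTT : T = LinearMap.toMatrix' T 1 1 • LinearMap.id := by
    conv_lhs => rw [← Matrix.toLin'_toMatrix' T, hs]
    rw [map_smul, Matrix.toLin'_one]
  apply Action.Hom.ext
  apply InducedCategory.hom_ext
  apply ModuleCat.hom_ext
  exact hTT.symm

end Irr

section Fin
open Matrix Finset CategoryTheory
set_option linter.unusedSectionVars false
set_option linter.unusedSimpArgs false

variable {F : Type*} [Field F] [Fintype F] [DecidableEq F]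

lemma Phi_iota_conj (X : SL2 F) : Phi F (iotaSL F X) = MulAut.conj (mkP F X) := by
  ext z
  obtain ⟨Z, rfl⟩ := mkP_surj z
  rw [Phi_iota, MulAut.conj_apply, map_mul, map_mul, map_inv]

lemma mem_inn_iff (α : MulAut (PSL2 F)) :
    α ∈ innAut (PSL2 F) ↔ ∃ X : SL2 F, α = Phi F (iotaSL F X) := by
  constructor
  · rintro ⟨s, rfl⟩
    obtain ⟨X, rfl⟩ := mkP_surj s
    exact ⟨X, (Phi_iota_conj X).symm⟩
  · rintro ⟨X, rfl⟩
    exact ⟨mkP F X, (Phi_iota_conj X).symm⟩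

lemma det_entries (g : GL (Fin 2) F) : (Matrix.GeneralLinearGroup.det g : F) =
    g 0 0 * g 1 1 - g 0 1 * g 1 0 := by
  change Matrix.det (g : Matrix (Fin 2) (Fin 2) F) = _
  rw [Matrix.det_fin_two]

lemma Phi_sq_mem (g : GL (Fin 2) F) (h : IsSquare (Matrix.GeneralLinearGroup.det g : F)) :
    Phi F (SemidirectProduct.inl g) ∈ innAut (PSL2 F) := by
  obtain ⟨r, hr⟩ := h
  have hr0 : r ≠ 0 := by
    rintro rfl
    have : (Matrix.GeneralLinearGroup.det g : F) ≠ 0 := Units.ne_zero _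
    rw [hr] at this
    simp at this
  rw [det_entries] at hr
  rw [mem_inn_iff]
  let X : SL2 F := ⟨!![r⁻¹ * g 0 0, r⁻¹ * g 0 1; r⁻¹ * g 1 0, r⁻¹ * g 1 1], by
    rw [Matrix.det_fin_two_of]
    field_simp
    linear_combination hr⟩
  have hX : ∀ i j, g i j = r * (iotaSL F X).left i j := by
    intro i j
    have : (iotaSL F X).left i j = r⁻¹ * g i j := by
      fin_cases i <;> fin_cases j <;> rfl
    rw [this, mul_inv_cancel_left₀ hr0]
  refine ⟨X, ?_⟩
  ext z
  obtain ⟨Z, rfl⟩ := mkP_surj z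
  rw [Phi_mk, Phi_mk]
  congr 1
  apply slAct_eq
  intro i j
  have := slAct_ent (iotaSL F X) Z i j
  rw [SemidirectProduct.left_inl, SemidirectProduct.right_inl, hX, hX, hX, hX]
  have e : (iotaSL F X).right = 1 := rfl
  rw [e] at this
  linear_combination r * this

lemma units_cube (v : ℤˣ) (h : v * v * v = 1) : v = 1 := by
  rcases Int.units_eq_one_or v with rfl | rfl
  · rfl
  · exact absurd h (by decide)

lemma hom_triv [CharP F 3] (v : SL2 F →* ℤˣ) (X : SL2 F) : v X = 1 := by
  have h3 : (3 : F) = 0 := by exact_mod_cast CharP.cast_eq_zero F 3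
  have hU : ∀ b, v (Uu b) = 1 := by
    intro b
    apply units_cube
    rw [← map_mul, ← map_mul, ← Uu_add, ← Uu_add, ← map_one v, ← Uu_zero]
    congr 2
    linear_combination b * h3
  have hW : v (Ww F) = 1 := by
    have e : (Ww F)⁻¹ = - Ww F := by
      rw [inv_eq_iff_mul_eq_one]
      apply sl_ext <;> simp [sl_mul_apply, sl_neg_apply, -Matrix.SpecialLinearGroup.coe_mul,
        -Matrix.SpecialLinearGroup.coe_neg]
    have : Ww F = Uu (-1) * (Ww F * Uu (-1) * (Ww F)⁻¹) * Uu (-1) := by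
      rw [e]
      apply sl_ext <;> simp [sl_mul_apply, sl_neg_apply, -Matrix.SpecialLinearGroup.coe_mul,
        -Matrix.SpecialLinearGroup.coe_neg]
    rw [this]
    simp only [map_mul, hU, map_inv]
    simp
  refine sl_gen (fun X => v X = 1) hU hW ?_ ?_ X
  · intro X Y h1 h2
    rw [map_mul, h1, h2, one_mul]
  · intro X h1
    rw [map_inv, h1, inv_one]

/-- determinant modulo squares -/
noncomputable def detChar (F : Type*) [Field F] [Fintype F] [DecidableEq F] : PGL2 F →* ℤˣ :=
  QuotientGroup.lift _ ((quadraticChar F).toUnitHom.comp Matrix.GeneralLinearGroup.det) (by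
    intro z hz
    rw [Matrix.GeneralLinearGroup.mem_center_iff_val_mem_range_scalar] at hz
    obtain ⟨a, ha⟩ := hz
    have hd : (Matrix.GeneralLinearGroup.det z : F) = a ^ 2 := by
      change Matrix.det (z : Matrix (Fin 2) (Fin 2) F) = _
      rw [← ha]
      simp
    have ha0 : a ≠ 0 := by
      rintro rfl
      have : (Matrix.GeneralLinearGroup.det z : F) ≠ 0 := Units.ne_zero _
      rw [hd] at this
      simp at this
    apply Units.ext
    rw [MonoidHom.comp_apply, MulChar.coe_toUnitHom, hd, map_pow, quadraticChar_sq_one ha0]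
    rfl)

lemma contains_PGL [CharP F 3] (hsq : ¬ IsSquare (-1 : F)) (n : ℕ) (hn : Odd n)
    (hA : ∀ σ : RingAut F, σ ^ n = 1)
    (H : Subgroup (MulAut (PSL2 F))) (hH : innAut (PSL2 F) ≤ H) (e : H ≃* PGL2 F)
    (g' : GL (Fin 2) F) : Phi F (SemidirectProduct.inl g') ∈ H := by
  let χ : H →* ℤˣ := (detChar F).comp e.toMonoidHom
  have hinn : ∀ X : SL2 F, Phi F (iotaSL F X) ∈ H := fun X => hH ((mem_inn_iff _).2 ⟨X, rfl⟩)
  let j : SL2 F →* H := ((Phi F).comp (iotaSL F)).codRestrict H hinn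
  have htriv : ∀ X : SL2 F, χ ⟨_, hinn X⟩ = 1 := fun X => hom_triv (χ.comp j) X
  have hχ : ∃ h : H, χ h = -1 := by
    refine ⟨e.symm (QuotientGroup.mk (mkGL (-1) 0 0 1 (by simp))), ?_⟩
    change detChar F (e (e.symm _)) = -1
    rw [e.apply_symm_apply]
    change (quadraticChar F).toUnitHom (Matrix.GeneralLinearGroup.det _) = -1
    apply Units.ext
    rw [MulChar.coe_toUnitHom, det_entries]
    simp only [mkGL_00, mkGL_01, mkGL_10, mkGL_11, mul_one, mul_zero, sub_zero]
    rw [quadraticChar_neg_one_iff_not_isSquare.2 hsq]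
    rfl
  obtain ⟨h, hh⟩ := hχ
  obtain ⟨γ, hγ⟩ := Phi_surj (isSquare_or_neg hsq) (h : MulAut (PSL2 F))
  have hr : (γ ^ n).right = 1 := by
    have : (γ ^ n).right = γ.right ^ n := map_pow (SemidirectProduct.rightHom) γ n
    rw [this, hA]
  have hl : γ ^ n = SemidirectProduct.inl (γ ^ n).left := by
    apply SemidirectProduct.ext
    · rfl
    · rw [hr]; rfl
  set g := (γ ^ n).left with hg
  have hmem : ((h ^ n : H) : MulAut (PSL2 F)) = Phi F (SemidirectProduct.inl g) := by
    rw [← hl, map_pow, hγ]; rfl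
  have hns : ¬ IsSquare (Matrix.GeneralLinearGroup.det g : F) := by
    intro hs
    obtain ⟨X, hX⟩ := (mem_inn_iff _).1 (Phi_sq_mem g hs)
    have h1 : h ^ n = ⟨_, hinn X⟩ := Subtype.ext (by rw [hmem, hX])
    have h2 := htriv X
    rw [← h1, map_pow, hh, hn.neg_one_pow] at h2
    exact absurd h2 (by decide)
  by_cases hs : IsSquare (Matrix.GeneralLinearGroup.det g' : F)
  · exact hH (Phi_sq_mem g' hs)
  · have hs2 : IsSquare (Matrix.GeneralLinearGroup.det (g' * g) : F) := by
      have a1 := (isSquare_or_neg hsq (Matrix.GeneralLinearGroup.det g : F)).resolve_left hns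
      have a2 := (isSquare_or_neg hsq (Matrix.GeneralLinearGroup.det g' : F)).resolve_left hs
      have := a2.mul a1
      rw [neg_mul_neg] at this
      rw [map_mul]
      exact this
    have h1 := hH (Phi_sq_mem _ hs2)
    rw [map_mul, map_mul, ← hmem] at h1
    exact (Subgroup.mul_mem_cancel_right H (h ^ n).2).1 h1

lemma main_gen {F : Type} [Field F] [Fintype F] [DecidableEq F] [CharP F 3]
    (hsq : ¬ IsSquare (-1 : F)) (ψ : AddChar F ℂ) (hψ : ψ ≠ 1)
    (hA : ∀ (σ : RingAut F) x, ψ (σ x) = ψ x) (G : Subgroup (MulAut (PSL2 F)))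
    (hG : ∀ g, Phi F (SemidirectProduct.inl g) ∈ G) :
    (∃ V : FDRep ℂ ↥G, Simple V ∧ (∀ g : ↥G, ∃ q : ℚ, V.character g = (q : ℂ)) ∧
        Even (Module.finrank ℂ V) ∧
        ∃ g : ↥G, (↑g : MulAut (PSL2 F)) ∈ innAut (PSL2 F) ∧
          V.character g ≠ V.character 1) ∧
      (∃ x : ↥G, (↑x : MulAut (PSL2 F)) ∈ innAut (PSL2 F) ∧
        x ≠ 1 ∧ Odd (orderOf x) ∧ IsRationalElement x) := by
  have hUe : Phi F (SemidirectProduct.inl (mkGL (1 : F) 1 0 1 (by simp))) =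
      Phi F (iotaSL F (Uu 1)) := by
    congr 1
    apply SemidirectProduct.ext
    · apply gl_ext <;> rfl
    · rfl
  have hU : Phi F (iotaSL F (Uu 1)) ∈ G := by rw [← hUe]; exact hG _
  have hUi : Phi F (iotaSL F (Uu 1)) ∈ innAut (PSL2 F) := (mem_inn_iff _).2 ⟨_, rfl⟩
  have hcard : (Fintype.card Fˣ : ℂ) = (Fintype.card F : ℂ) - 1 := by
    rw [Fintype.card_units, Nat.cast_sub Fintype.card_pos]; simp
  have htr : (RA hsq ψ hψ hA (Phi F (iotaSL F (Uu 1)))).trace = -1 := by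
    rw [← hUe, RA_inl, kir_U, Matrix.trace_diagonal]
    have h1 := sum_units (F := F) (fun y => ψ (1 * y) - 1) (by simp)
    have h2 := sum_lin ψ hψ (1 : F)
    rw [if_neg one_ne_zero] at h2
    rw [Finset.sum_sub_distrib, Finset.sum_sub_distrib, h2] at h1
    simp only [Finset.sum_const, Finset.card_univ, nsmul_eq_mul, mul_one, hcard] at h1
    linear_combination h1
  constructor
  · refine ⟨FDRep.of (rhoG hsq ψ hψ hA G), simpleG hsq ψ hψ hA G hG, ?_, ?_, ?_⟩
    · intro g
      rw [char_eq]
      exact RR_trace_rat hsq ψ hψ hA _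
    · have : Module.finrank ℂ (Fˣ → ℂ) = Fintype.card F - 1 := by
        rw [Module.finrank_fintype_fun_eq_card, Fintype.card_units]
      have h2 : Even (Module.finrank ℂ (Fˣ → ℂ)) := by
        rw [this]
        have ho := FiniteField.odd_card_of_char_ne_two (F := F) ringChar_ne_two
        exact Nat.Odd.sub_odd (Nat.odd_iff.2 ho) odd_one
      exact h2
    · refine ⟨⟨_, hU⟩, hUi, ?_⟩
      rw [char_eq, char_eq]
      change (RA hsq ψ hψ hA (Phi F (iotaSL F (Uu 1)))).trace ≠ (RA hsq ψ hψ hA 1).trace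
      rw [htr, map_one, Matrix.trace_one, hcard]
      intro h
      have : (Fintype.card F : ℂ) = 0 := by linear_combination -h
      exact Fintype.card_ne_zero (Nat.cast_eq_zero.1 this)
  · set x : G := ⟨_, hU⟩ with hx
    have hx3 : x ^ 3 = 1 := by
      apply Subtype.ext
      change (Phi F (iotaSL F (Uu 1))) ^ 3 = 1
      rw [Phi_iota_conj, ← map_pow, mkU_three, map_one]
    have hx1 : x ≠ 1 := by
      intro h
      have h1 : Phi F (iotaSL F (Uu (1 : F))) = 1 := congrArg Subtype.val h
      have := (Phi_ker _ h1).2.2.1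
      exact one_ne_zero this
    have hfact : Fact (Nat.Prime 3) := ⟨by norm_num⟩
    have ho : orderOf x = 3 := orderOf_eq_prime hx3 hx1
    refine ⟨x, hUi, hx1, by rw [ho]; decide, ?_⟩
    intro y hy
    have hyx : y ∈ Subgroup.zpowers x := by rw [← hy]; exact Subgroup.mem_zpowers y
    have hfin : IsOfFinOrder x := isOfFinOrder_iff_pow_eq_one.2 ⟨3, by norm_num, hx3⟩
    have hpow : ∃ k < 3, x ^ k = y := by
      rw [← ho]
      obtain ⟨k, hk⟩ := (hfin.mem_powers_iff_mem_zpowers).2 hyx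
      refine ⟨k % orderOf x, Nat.mod_lt _ hfin.orderOf_pos, ?_⟩
      rw [pow_mod_orderOf]; exact hk
    obtain ⟨k, hk, rfl⟩ := hpow
    interval_cases k
    · exfalso
      rw [pow_zero, Subgroup.zpowers_one_eq_bot] at hy
      have : x ∈ (⊥ : Subgroup G) := by rw [hy]; exact Subgroup.mem_zpowers x
      exact hx1 (Subgroup.mem_bot.1 this)
    · rw [pow_one]
    · rw [isConj_iff]
      refine ⟨⟨_, hG (mkGL (-1) 0 0 1 (by simp))⟩, ?_⟩
      rw [mul_inv_eq_iff_eq_mul]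
      apply Subtype.ext
      change Phi F (SemidirectProduct.inl _) * Phi F (iotaSL F (Uu 1)) =
        Phi F (iotaSL F (Uu 1)) ^ 2 * Phi F (SemidirectProduct.inl _)
      rw [← map_pow, ← map_pow, ← map_mul, ← map_mul]
      congr 1
      have h3 : (3 : F) = 0 := by exact_mod_cast CharP.cast_eq_zero F 3
      apply SemidirectProduct.ext
      · have e1 : Uu (1 : F) ^ 2 = Uu (-1) := by
          rw [sq, ← Uu_add]; congr 1; linear_combination h3
        rw [e1]
        change mkGL (-1 : F) 0 0 1 (by simp) * (glAut F 1 (Matrix.SpecialLinearGroup.toGL (Uu 1))) =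
          Matrix.SpecialLinearGroup.toGL (Uu (-1)) * glAut F 1 (mkGL (-1 : F) 0 0 1 (by simp))
        rw [map_one]
        have hu : ∀ (b : F) i j, Matrix.SpecialLinearGroup.toGL (Uu b) i j = Uu b i j :=
          fun b i j => rfl
        apply gl_ext <;> simp only [gl_mul_apply, MulAut.one_apply, hu, mkGL_00, mkGL_01,
          mkGL_10, mkGL_11, Uu00, Uu01, Uu10, Uu11] <;> ring
      · rfl

end Fin


/-- For `S = PSL₂(3^f)` (`f ≥ 3` odd) and `Inn(S) < G ≤ Aut(S)`: if some subgroup `H` with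
`Inn(S) < H ≤ G` is isomorphic to `PGL₂(3^f)`, then `G` has a rational irreducible character
of even degree whose kernel does not contain `Inn(S)`, and a non-trivial rational element of
odd order lying in `Inn(S)`. -/
theorem rational_char_of_pgl (f : ℕ) (hf : Odd f) (hf3 : 3 ≤ f)
    (G H : Subgroup (MulAut (PSL2 (GaloisField 3 f))))
    (hG : innAut (PSL2 (GaloisField 3 f)) < G)
    (hH : innAut (PSL2 (GaloisField 3 f)) < H) (hHG : H ≤ G)
    (hpgl : Nonempty (↥H ≃* PGL2 (GaloisField 3 f))) :
    (∃ V : FDRep ℂ ↥G, Simple V ∧ (∀ g : ↥G, ∃ q : ℚ, V.character g = (q : ℂ)) ∧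
        Even (Module.finrank ℂ V) ∧
        ∃ g : ↥G, (↑g : MulAut (PSL2 (GaloisField 3 f))) ∈ innAut (PSL2 (GaloisField 3 f)) ∧
          V.character g ≠ V.character 1) ∧
      (∃ x : ↥G, (↑x : MulAut (PSL2 (GaloisField 3 f))) ∈ innAut (PSL2 (GaloisField 3 f)) ∧
        x ≠ 1 ∧ Odd (orderOf x) ∧ IsRationalElement x) := by
  classical
  let F := GaloisField 3 f
  have hf0 : f ≠ 0 := by omega
  let _ : Fintype F := Fintype.ofFinite F
  have hcard : Fintype.card F = 3 ^ f := by
    rw [← Nat.card_eq_fintype_card]; exact GaloisField.card 3 f hf0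
  have hsq : ¬ IsSquare (-1 : F) := by
    rw [FiniteField.isSquare_neg_one_iff, hcard]
    obtain ⟨k, rfl⟩ := hf
    rw [pow_succ, pow_mul, Nat.mul_mod, Nat.pow_mod]
    norm_num
  let toAlg : RingAut F → (F ≃ₐ[ZMod 3] F) := fun σ =>
    AlgEquiv.ofRingEquiv (f := σ) (fun r => by
      have h := RingHom.congr_fun (Subsingleton.elim
        ((σ : F →+* F).comp (algebraMap (ZMod 3) F)) (algebraMap (ZMod 3) F)) r
      exact h)
  have hA : ∀ σ : RingAut F, σ ^ f = 1 := by
    intro σ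
    have h1 : (toAlg σ) ^ f = 1 := by
      have h2 : Nat.card (F ≃ₐ[ZMod 3] F) = f := by
        rw [IsGalois.card_aut_eq_finrank]; exact GaloisField.finrank 3 hf0
      have h4 : (toAlg σ) ^ Nat.card (F ≃ₐ[ZMod 3] F) = 1 := pow_card_eq_one'
      rwa [h2] at h4
    have h3 : ∀ (k : ℕ) (x : F), (σ ^ k) x = ((toAlg σ) ^ k) x := by
      intro k
      induction k with
      | zero => intro x; rfl
      | succ k ih =>
        intro x
        rw [pow_succ, pow_succ]
        exact ih (σ x)
    apply RingEquiv.ext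
    intro x
    rw [h3, h1]
    rfl
  let ψ : AddChar F ℂ := (ZMod.stdAddChar (N := 3)).compAddMonoidHom
    (Algebra.trace (ZMod 3) F).toAddMonoidHom
  have hψa : ∀ x, ψ x = ZMod.stdAddChar (Algebra.trace (ZMod 3) F x) := fun x => rfl
  have hψ : ψ ≠ 1 := by
    intro h
    obtain ⟨x, hx⟩ := Algebra.trace_surjective (ZMod 3) F 1
    have h1 := hψa x
    rw [h, hx, AddChar.one_apply, ← AddChar.map_zero_eq_one (ZMod.stdAddChar (N := 3))] at h1
    have := ZMod.injective_stdAddChar h1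
    exact absurd this (by decide)
  have hψA : ∀ (σ : RingAut F) x, ψ (σ x) = ψ x := by
    intro σ x
    rw [hψa, hψa]
    congr 1
    exact Algebra.trace_eq_of_algEquiv (toAlg σ) x
  obtain ⟨e⟩ := hpgl
  exact main_gen hsq ψ hψ hψA G (fun g => hHG (contains_PGL hsq f hf hA H hH.le e g))
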